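/- arXiv:2411.12927 — 8 statements merged into one kernel-verified Lean document; each statement's English description precedes it below -/
import Mathlib

section
/- Let X be a second countable Stone space, x ∈ X, and U a clopen neighborhood of x. Then the following are equivalent: (i) for every clopen neighborhood U' ⊆ U of x there is a homeomorphism Φ : U → U' with Φ(x) = x; (ii) for every clopen neighborhood U' ⊆ U of x there exist a clopen neighborhood U'' ⊆ U' of x and a homeomorphism Φ : U → U'' with Φ(x) = x. -/
open Pointwise Topology

/-- The map sending `E n d` to `E (n + 1) d` and fixing every point outside the ranges of the
`E n`. -/
noncomputable def shiftMap {X D : Type*} (E : ℕ → D → X) : X → X :=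
  Function.extend (fun p : ℕ × D => E p.1 p.2) (fun p => E (p.1 + 1) p.2) id

section ShiftMap

variable {X D : Type*} {E : ℕ → D → X}

theorem shiftMap_apply (hE : Function.Injective fun p : ℕ × D => E p.1 p.2) (n : ℕ) (d : D) :
    shiftMap E (E n d) = E (n + 1) d :=
  hE.extend_apply (fun p : ℕ × D => E (p.1 + 1) p.2) id (n, d)

theorem shiftMap_of_forall_ne {y : X} (hy : ∀ n d, E n d ≠ y) : shiftMap E y = y :=
  Function.extend_apply' _ _ _ fun ⟨p, hp⟩ => hy p.1 p.2 hp

theorem shiftMap_injective (hE : Function.Injective fun p : ℕ × D => E p.1 p.2) :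
    Function.Injective (shiftMap E) := by
  intro y z hyz
  by_cases hy : ∃ n d, E n d = y <;> by_cases hz : ∃ n d, E n d = z
  · obtain ⟨n, d, rfl⟩ := hy
    obtain ⟨m, c, rfl⟩ := hz
    rw [shiftMap_apply hE, shiftMap_apply hE] at hyz
    have h := @hE (n + 1, d) (m + 1, c) hyz
    simp only [Prod.mk.injEq, Nat.add_right_cancel_iff] at h
    rw [h.1, h.2]
  · obtain ⟨n, d, rfl⟩ := hy
    push Not at hz
    rw [shiftMap_apply hE, shiftMap_of_forall_ne hz] at hyz
    exact absurd hyz (hz _ _)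
  · obtain ⟨m, c, rfl⟩ := hz
    push Not at hy
    rw [shiftMap_apply hE, shiftMap_of_forall_ne hy] at hyz
    exact absurd hyz.symm (hy _ _)
  · push Not at hy hz
    rwa [shiftMap_of_forall_ne hy, shiftMap_of_forall_ne hz] at hyz

theorem continuous_shiftMap [TopologicalSpace X] [T2Space X] [TopologicalSpace D]
    [CompactSpace D] {x : X} (hE : Function.Injective fun p : ℕ × D => E p.1 p.2)
    (hopen : ∀ n, IsOpenEmbedding (E n)) (hx : ∀ n d, E n d ≠ x)
    (hlim : ∀ W ∈ 𝓝 x, ∃ N, ∀ n ≥ N, ∀ d, E n d ∈ W) : Continuous (shiftMap E) := by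
  have avoid : ∀ y, (∀ n d, E n d ≠ y) → ∀ N, ∀ᶠ z in 𝓝 y, ∀ n < N, ∀ d, E n d ≠ z := by
    intro y hy N
    have h : ∀ n ∈ Set.Iio N, ∀ᶠ z in 𝓝 y, ∀ d, E n d ≠ z := by
      intro n _
      have hcl : IsClosed (Set.range (E n)) := (isCompact_range (hopen n).continuous).isClosed
      filter_upwards [hcl.isOpen_compl.mem_nhds fun ⟨d, hd⟩ => hy n d hd] with z hz d hd
      exact hz ⟨d, hd⟩
    exact (Filter.eventually_all_finite (Set.finite_Iio N)).2 h
  rw [continuous_iff_continuousAt]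
  intro y
  by_cases hy : ∃ n d, E n d = y
  · obtain ⟨n, d, rfl⟩ := hy
    rw [← (hopen n).continuousAt_iff,
      show shiftMap E ∘ E n = E (n + 1) from funext fun d => shiftMap_apply hE n d]
    exact (hopen (n + 1)).continuous.continuousAt
  push Not at hy
  by_cases hyx : y = x
  · subst hyx
    rw [ContinuousAt, shiftMap_of_forall_ne hy]
    intro W hW
    obtain ⟨N, hN⟩ := hlim W hW
    rw [Filter.mem_map]
    filter_upwards [avoid y hy N, hW] with z hz hzW
    rw [Set.mem_preimage]
    by_cases hzE : ∃ n d, E n d = z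
    · obtain ⟨n, d, rfl⟩ := hzE
      rw [shiftMap_apply hE]
      have hn : N ≤ n := not_lt.1 fun h => hz n h d rfl
      exact hN _ (by lia) d
    · push Not at hzE
      rwa [shiftMap_of_forall_ne hzE]
  · obtain ⟨A, B, hA, hB, hyA, hxB, hAB⟩ := t2_separation hyx
    obtain ⟨N, hN⟩ := hlim B (hB.mem_nhds hxB)
    have hid : shiftMap E =ᶠ[𝓝 y] id := by
      filter_upwards [avoid y hy N, hA.mem_nhds hyA] with z hz hzA
      refine shiftMap_of_forall_ne fun n d hnd => ?_
      rcases lt_or_ge n N with hn | hn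
      · exact hz n hn d hnd
      · exact hAB.le_bot ⟨hzA, hnd ▸ hN n hn d⟩
    exact continuousAt_id.congr hid.symm

end ShiftMap

/-- If a compact open set `D` avoiding `x` embeds as an open set avoiding `x` into every clopen
neighborhood of `x`, then there are pairwise disjoint such copies of `D` converging to `x`, the
zeroth one being `D` itself and the others lying in a given neighborhood `V` disjoint from `D`. -/
theorem exists_seq_isOpenEmbedding_tendsto {X : Type*} [TopologicalSpace X] [CompactSpace X]
    [T2Space X] [TotallyDisconnectedSpace X] [FirstCountableTopology X] {x : X} {D V : Set X}
    (hD : IsClopen D) (hV : IsClopen V) (hVx : x ∈ V) (hDV : Disjoint D V)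
    (hemb : ∀ W : Set X, IsClopen W → x ∈ W →
      ∃ e : D → X, IsOpenEmbedding e ∧ ∀ d, e d ∈ W ∧ e d ≠ x) :
    ∃ E : ℕ → D → X, E 0 = Subtype.val ∧ (∀ n d, E (n + 1) d ∈ V) ∧
      Function.Injective (fun p : ℕ × D => E p.1 p.2) ∧ (∀ n, IsOpenEmbedding (E n)) ∧
      (∀ n d, E n d ≠ x) ∧ ∀ W ∈ 𝓝 x, ∃ N, ∀ n ≥ N, ∀ d, E n d ∈ W := by
  have : CompactSpace D := isCompact_iff_compactSpace.1 hD.isClosed.isCompact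
  obtain ⟨B, hB⟩ := (𝓝 x).exists_antitone_basis
  let S := {W : Set X // IsClopen W ∧ x ∈ W}
  have hemb' : ∀ W : S, ∃ e : D → X, IsOpenEmbedding e ∧ ∀ d, e d ∈ W.1 ∧ e d ≠ x :=
    fun W => hemb W.1 W.2.1 W.2.2
  choose e he heW using hemb'
  have hnext : ∀ (n : ℕ) (W : S), ∃ W' : S, W'.1 ⊆ W.1 ∧ (∀ d, e W d ∉ W'.1) ∧ W'.1 ⊆ B n := by
    intro n W
    have hcl : IsClosed (Set.range (e W)) := (isCompact_range (he W).continuous).isClosed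
    have hmem : W.1 ∩ (Set.range (e W))ᶜ ∩ B n ∈ 𝓝 x :=
      Filter.inter_mem (Filter.inter_mem (W.2.1.isOpen.mem_nhds W.2.2)
        (hcl.isOpen_compl.mem_nhds fun ⟨d, hd⟩ => (heW W d).2 hd)) (hB.1.mem_of_mem trivial)
    obtain ⟨W', ⟨hxW', hW'⟩, hsub⟩ := (nhds_basis_clopen x).mem_iff.1 hmem
    exact ⟨⟨W', hW', hxW'⟩, fun z hz => (hsub hz).1.1,
      fun d hd => (hsub hd).1.2 ⟨d, rfl⟩, fun z hz => (hsub hz).2⟩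
  choose next hsub havoid hbasis using hnext
  let T : ℕ → S := fun n => Nat.rec ⟨V, hV, hVx⟩ (fun k W => next k W) n
  have hT : Antitone fun n => (T n).1 := antitone_nat_of_succ_le fun n => hsub n (T n)
  let E : ℕ → D → X := fun n => Nat.casesOn n Subtype.val fun k => e (T k)
  have hEV : ∀ n d, E (n + 1) d ∈ V := fun n d => hT (Nat.zero_le n) (heW (T n) d).1
  have hopen : ∀ n, IsOpenEmbedding (E n)
    | 0 => hD.isOpen.isOpenEmbedding_subtypeVal
    | n + 1 => he (T n)
  have hdisj : ∀ i j, i < j → ∀ c d, E i c ≠ E j d := by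
    intro i j hij c d h
    obtain ⟨k, rfl⟩ := Nat.exists_eq_add_one_of_ne_zero (Nat.ne_zero_of_lt hij)
    cases i with
    | zero => exact hDV.le_bot ⟨c.2, show (c : X) ∈ V from (show (c : X) = _ from h) ▸ hEV k d⟩
    | succ m =>
      refine havoid m (T m) c ?_
      have hk : E (k + 1) d ∈ (T (m + 1)).1 := hT (show m + 1 ≤ k by lia) (heW (T k) d).1
      rw [← h] at hk
      exact hk
  refine ⟨E, rfl, hEV, ?_, hopen, ?_, ?_⟩
  · rintro ⟨i, c⟩ ⟨j, d⟩ h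
    rcases lt_trichotomy i j with hij | rfl | hij
    · exact absurd h (hdisj i j hij c d)
    · exact congrArg (Prod.mk i) ((hopen i).injective h)
    · exact absurd h.symm (hdisj j i hij d c)
  · rintro (_ | n) d
    · exact fun h => hDV.le_bot ⟨d.2, (show (d : X) = x from h) ▸ hVx⟩
    · exact (heW (T n) d).2
  · intro W hW
    obtain ⟨N, -, hN⟩ := hB.1.mem_iff.1 hW
    refine ⟨N + 2, fun n hn d => ?_⟩
    obtain ⟨k, rfl⟩ : ∃ k, n = k + 1 := ⟨n - 1, by lia⟩
    exact hN (hbasis N (T N) (hT (show N + 1 ≤ k by lia) (heW (T k) d).1))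

/-- Proposition 3.2, (i) ⟺ (ii): `U` is stable with respect to `x` iff for every clopen
neighborhood `U' ⊆ U` of `x` there are a clopen neighborhood `U'' ⊆ U'` of `x` and a
homeomorphism `U ≃ₜ U''` fixing `x`. -/
theorem stableNbhd_iff_weak (X : Type*) [TopologicalSpace X] [CompactSpace X]
    [TopologicalSpace.MetrizableSpace X] [TotallyDisconnectedSpace X] [Nonempty X]
    (x : X) (U : Set X) (hU : IsClopen U) (hUx : U ∈ nhds x) :
    (∀ U' : Set X, U' ⊆ U → IsClopen U' → U' ∈ nhds x →
        ∃ Φ : (U : Set X) ≃ₜ (U' : Set X), ∀ hx : x ∈ U, ((Φ ⟨x, hx⟩ : U') : X) = x) ↔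
    (∀ U' : Set X, U' ⊆ U → IsClopen U' → U' ∈ nhds x →
        ∃ U'' : Set X, U'' ⊆ U' ∧ IsClopen U'' ∧ U'' ∈ nhds x ∧
          ∃ Φ : (U : Set X) ≃ₜ (U'' : Set X), ∀ hx : x ∈ U, ((Φ ⟨x, hx⟩ : U'') : X) = x) := by
  refine ⟨fun h U' hsub hcl hx => ⟨U', subset_rfl, hcl, hx, h U' hsub hcl hx⟩, ?_⟩
  intro h U' hsub hcl hx
  have hxU : x ∈ U := mem_of_mem_nhds hUx
  have hxU' : x ∈ U' := mem_of_mem_nhds hx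
  have hD : IsClopen (U \ U') := hU.diff hcl
  have : CompactSpace (U \ U' : Set X) := isCompact_iff_compactSpace.1 hD.isClosed.isCompact
  have : CompactSpace U := isCompact_iff_compactSpace.1 hU.isClosed.isCompact
  have hemb : ∀ W : Set X, IsClopen W → x ∈ W →
      ∃ e : (U \ U' : Set X) → X, IsOpenEmbedding e ∧ ∀ d, e d ∈ W ∧ e d ≠ x := by
    intro W hW hxW
    obtain ⟨U'', hsub'', hcl'', -, Φ, hΦ⟩ := h (W ∩ U) Set.inter_subset_right (hW.inter hU)
      (Filter.inter_mem (hW.isOpen.mem_nhds hxW) hUx)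
    refine ⟨fun d => Φ (Set.inclusion Set.sdiff_subset d), ?_, fun d => ⟨?_, fun hd => ?_⟩⟩
    · exact hcl''.isOpen.isOpenEmbedding_subtypeVal.comp (Φ.isOpenEmbedding.comp
        (.inclusion Set.sdiff_subset (hD.isOpen.preimage continuous_subtype_val)))
    · exact (hsub'' (Φ _).2).1
    · have hdx := congrArg Subtype.val (Φ.injective (Subtype.ext (hd.trans (hΦ hxU).symm)))
      exact d.2.2 ((show (d : X) = x from hdx) ▸ hxU')
  obtain ⟨E, hE0, hEU', hE, hopen, hEx, hlim⟩ :=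
    exists_seq_isOpenEmbedding_tendsto hD hcl hxU' Set.disjoint_sdiff_left hemb
  have hEU : ∀ n d, E n d ∈ U
    | 0, d => by rw [hE0]; exact d.2.1
    | n + 1, d => hsub (hEU' n d)
  have hmaps : ∀ y ∈ U, shiftMap E y ∈ U' := by
    intro y hy
    by_cases hyE : ∃ n d, E n d = y
    · obtain ⟨n, d, rfl⟩ := hyE
      rw [shiftMap_apply hE]
      exact hEU' n d
    · push Not at hyE
      rw [shiftMap_of_forall_ne hyE]
      by_contra hyU'
      exact hyE 0 ⟨y, hy, hyU'⟩ (by rw [hE0])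
  let f : U → U' := fun y => ⟨shiftMap E y, hmaps y y.2⟩
  have hf : Continuous f :=
    ((continuous_shiftMap hE hopen hEx hlim).comp continuous_subtype_val).subtype_mk _
  have hbij : Function.Bijective f := by
    refine ⟨fun y z hyz => Subtype.ext (shiftMap_injective hE (congrArg Subtype.val hyz)), ?_⟩
    rintro ⟨z, hz⟩
    by_cases hzE : ∃ n d, E n d = z
    · obtain ⟨_ | n, d, rfl⟩ := hzE
      · rw [hE0] at hz
        exact absurd hz d.2.2
      · exact ⟨⟨E n d, hEU n d⟩, Subtype.ext (shiftMap_apply hE n d)⟩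
    · push Not at hzE
      exact ⟨⟨z, hsub hz⟩, Subtype.ext (shiftMap_of_forall_ne hzE)⟩
  exact ⟨Continuous.homeoOfEquivCompactToT2 (f := Equiv.ofBijective f hbij) hf,
    fun _ => shiftMap_of_forall_ne hEx⟩
end

section
/- Let A and B be topological spaces and let φ : A → A ⊔ B be a topological embedding whose image is a clopen subset of the disjoint union A ⊔ B. Then there is a self-homeomorphism Ψ of the disjoint union A ⊔ B ⊔ A whose restriction to the first summand A equals φ composed with the inclusion of A ⊔ B into A ⊔ B ⊔ A. -/
open Pointwise Topology

/-- An embedding with clopen range splits its codomain as the sum of its domain and the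
complement of its range. -/
theorem Topology.IsEmbedding.exists_homeomorph_sum_compl_range {A X : Type*} [TopologicalSpace A]
    [TopologicalSpace X] {φ : A → X} (hφ : IsEmbedding φ) (hcl : IsClopen (Set.range φ)) :
    ∃ e : A ⊕ ↥(Set.range φ)ᶜ ≃ₜ X, ∀ a, e (Sum.inl a) = φ a := by
  have hopen : IsOpenMap (Sum.elim φ (Subtype.val : ↥(Set.range φ)ᶜ → X)) :=
    (IsOpenEmbedding.mk hφ hcl.isOpen).isOpenMap.sumElim
      hcl.compl.isOpen.isOpenMap_subtype_val
  have hcont : Continuous (Sum.elim φ (Subtype.val : ↥(Set.range φ)ᶜ → X)) :=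
    hφ.continuous.sumElim continuous_subtype_val
  have hbij : Function.Bijective (Sum.elim φ (Subtype.val : ↥(Set.range φ)ᶜ → X)) := by
    refine ⟨hφ.injective.sumElim Subtype.val_injective fun a c h => c.2 ⟨a, h⟩, fun x => ?_⟩
    by_cases hx : x ∈ Set.range φ
    · obtain ⟨a, rfl⟩ := hx
      exact ⟨Sum.inl a, rfl⟩
    · exact ⟨Sum.inr ⟨x, hx⟩, rfl⟩
  exact ⟨(Equiv.ofBijective _ hbij).toHomeomorphOfContinuousOpen hcont hopen, fun _ => rfl⟩

/-- Lemma 3.7: if `φ : A → A ⊔ B` is an embedding onto a clopen subset, then there is a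
self-homeomorphism of `A ⊔ B ⊔ A` restricting to `φ` on the first summand. -/
theorem puzzle_lemma {A B : Type*} [TopologicalSpace A] [TopologicalSpace B]
    (φ : A → A ⊕ B) (hφ : Topology.IsEmbedding φ) (hcl : IsClopen (Set.range φ)) :
    ∃ Ψ : (A ⊕ B ⊕ A) ≃ₜ (A ⊕ B ⊕ A),
      ∀ a : A, Ψ (Sum.inl a) = Sum.map id Sum.inl (φ a) := by
  obtain ⟨e, he⟩ := hφ.exists_homeomorph_sum_compl_range hcl
  let complements : B ⊕ A ≃ₜ ↥(Set.range φ)ᶜ ⊕ A :=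
    (Homeomorph.sumComm B A).trans (e.symm.trans (Homeomorph.sumComm A _))
  refine ⟨((Homeomorph.refl A).sumCongr complements).trans
    ((Homeomorph.sumAssoc A _ A).symm.trans
      ((e.sumCongr (Homeomorph.refl A)).trans (Homeomorph.sumAssoc A B A))), fun a => ?_⟩
  change Homeomorph.sumAssoc A B A (Sum.inl (e (Sum.inl a))) = _
  rw [he]
  cases φ a <;> rfl
end

section
/- Let X be a second countable Stone space, x ∈ X, and Ω a stable clopen neighborhood of x, with a fixed decomposition Ω \ {x} = ⋃_{k≥1} Y_k as guaranteed by stability. Writing Y[n] := ⋃_{i=1}^{n} Y_i, the following holds: for every 1 ≤ n < m and every topological embedding φ : Y[n] → Y[m] whose image is a clopen subset of Y[m], there exist p > m and a homeomorphism h : Y[p] → Y[p] such that h agrees with φ on Y[n]. -/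
open Pointwise Topology

/-- `U` is a stable clopen neighborhood of `x`: for every clopen neighborhood `U' ⊆ U` of `x`
there is a homeomorphism `U ≃ₜ U'` fixing `x`. -/
def IsStableNbhd {X : Type*} [TopologicalSpace X] (x : X) (U : Set X) : Prop :=
  IsClopen U ∧ U ∈ nhds x ∧
    ∀ U' : Set X, U' ⊆ U → IsClopen U' → U' ∈ nhds x →
      ∃ Φ : (U : Set X) ≃ₜ (U' : Set X), ∀ hx : x ∈ U, ((Φ ⟨x, hx⟩ : U') : X) = x

/-- `Y k ↘ x`: every sequence of points chosen from the sets `Y k` converges to `x`. -/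
def DescendsTo {X : Type*} [TopologicalSpace X] (Y : ℕ → Set X) (x : X) : Prop :=
  ∀ u : ℕ → X, (∀ k, u k ∈ Y k) → Filter.Tendsto u Filter.atTop (nhds x)

/-- A decomposition `Ω \ {x} = ⋃ Y k` of a stable neighborhood as guaranteed by stability
(here `Y k` plays the role of `Y_{k+1}` of the paper): the pieces are nonempty, pairwise
disjoint and clopen, they descend to `x`, each `Y (k+1)` contains a clopen copy of `Y k`,
and for every infinite increasing sequence of indices `κ` the space `Ω \ {x}` is
homeomorphic to `⋃ n, Y (κ n)`. -/
structure IsStableDecomp {X : Type*} [TopologicalSpace X] (x : X) (Ω : Set X)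
    (Y : ℕ → Set X) : Prop where
  nonempty : ∀ k, (Y k).Nonempty
  clopen : ∀ k, IsClopen (Y k)
  disj : ∀ k l, k ≠ l → Disjoint (Y k) (Y l)
  union : Ω \ {x} = ⋃ k, Y k
  descends : DescendsTo Y x
  contains : ∀ k, ∃ Z : Set X, Z ⊆ Y (k + 1) ∧ IsClopen Z ∧
    Nonempty ((Y k : Set X) ≃ₜ (Z : Set X))
  subseq : ∀ κ : ℕ → ℕ, StrictMono κ →
    Nonempty (((Ω \ {x} : Set X)) ≃ₜ ((⋃ n, Y (κ n) : Set X)))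

/-- A brick relative to the decomposition `Y`: a union `⋃ k ∈ S, Y k` with `S` infinite
and co-infinite. -/
def IsBrick {X : Type*} [TopologicalSpace X] (Y : ℕ → Set X) (B : Set X) : Prop :=
  ∃ S : Set ℕ, S.Infinite ∧ Sᶜ.Infinite ∧ B = ⋃ k ∈ S, Y k

/-- `B` is a subbrick of the brick `A`, relative to the decomposition `Y`. -/
def IsSubbrick {X : Type*} [TopologicalSpace X] (Y : ℕ → Set X) (A B : Set X) : Prop :=
  ∃ S S' : Set ℕ, S.Infinite ∧ Sᶜ.Infinite ∧ S' ⊆ S ∧ S'.Infinite ∧ (S \ S').Infinite ∧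
    A = ⋃ k ∈ S, Y k ∧ B = ⋃ k ∈ S', Y k

/-- `f` is supported on `A`: it is the identity outside `A`. -/
def SuppOn {X : Type*} [TopologicalSpace X] (f : X ≃ₜ X) (A : Set X) : Prop :=
  ∀ y : X, y ∉ A → f y = y

/-- The set of homeomorphisms of `X` supported on `A`. -/
def suppIn {X : Type*} [TopologicalSpace X] (A : Set X) : Set (X ≃ₜ X) :=
  {f | SuppOn f A}

/-- The union of the first `n` pieces of the decomposition (`Y[n]` in the paper). -/
def blockUnion {X : Type*} [TopologicalSpace X] (Y : ℕ → Set X) (n : ℕ) : Set X :=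
  ⋃ i ∈ Finset.range n, Y i

/-- Two open embeddings of the same space with disjoint closed ranges are exchanged by a
self-homeomorphism of the ambient space. -/
theorem exists_homeomorph_of_disjoint_range {α T : Type*} [TopologicalSpace α]
    [TopologicalSpace T] {f g : α → T} (hf : IsOpenEmbedding f) (hg : IsOpenEmbedding g)
    (hfc : IsClosed (Set.range f)) (hgc : IsClosed (Set.range g))
    (hd : Disjoint (Set.range f) (Set.range g)) :
    ∃ s : T ≃ₜ T, (∀ a, s (f a) = g a) ∧ ∀ a, s (g a) = f a := by
  classical
  set F : T → T := Function.extend f g (Function.extend g f id) with hF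
  have hFf : ∀ a, F (f a) = g a := fun a => hf.injective.extend_apply _ _ _
  have hFg : ∀ a, F (g a) = f a := fun a => by
    have h : ¬ ∃ b, f b = g a := fun hb =>
      Set.disjoint_left.1 hd (Set.mem_range.2 hb) (Set.mem_range_self a)
    rw [hF, Function.extend_apply' _ _ _ h, hg.injective.extend_apply]
  have hFid : ∀ t, t ∉ Set.range f → t ∉ Set.range g → F t = t := fun t h1 h2 => by
    rw [hF, Function.extend_apply' _ _ _ h1, Function.extend_apply' _ _ _ h2, id]
  have hinv : Function.Involutive F := fun t => by
    by_cases h1 : t ∈ Set.range f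
    · obtain ⟨a, rfl⟩ := h1
      rw [hFf, hFg]
    by_cases h2 : t ∈ Set.range g
    · obtain ⟨a, rfl⟩ := h2
      rw [hFg, hFf]
    rw [hFid t h1 h2, hFid t h1 h2]
  have hcont : Continuous F := continuous_iff_continuousAt.2 fun t => by
    by_cases h1 : t ∈ Set.range f
    · obtain ⟨a, rfl⟩ := h1
      rw [← hf.continuousAt_iff, show F ∘ f = g from funext hFf]
      exact hg.continuous.continuousAt
    by_cases h2 : t ∈ Set.range g
    · obtain ⟨a, rfl⟩ := h2
      rw [← hg.continuousAt_iff, show F ∘ g = f from funext hFg]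
      exact hf.continuous.continuousAt
    refine continuousAt_id.congr ?_
    filter_upwards [hfc.isOpen_compl.mem_nhds h1, hgc.isOpen_compl.mem_nhds h2] with y hy1 hy2
    exact (hFid y hy1 hy2).symm
  exact ⟨⟨hinv.toPerm, hcont, hcont⟩, hFf, hFg⟩

theorem IsOpen.isOpenEmbedding_inclusion {X : Type*} [TopologicalSpace X] {s t : Set X}
    (hs : IsOpen s) (h : s ⊆ t) : IsOpenEmbedding (Set.inclusion h) :=
  ⟨.inclusion h, Set.range_inclusion h ▸ hs.preimage continuous_subtype_val⟩

theorem mem_blockUnion {X : Type*} [TopologicalSpace X] {Y : ℕ → Set X} {n : ℕ} {z : X} :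
    z ∈ blockUnion Y n ↔ ∃ k < n, z ∈ Y k := by
  simp [blockUnion]

theorem blockUnion_mono {X : Type*} [TopologicalSpace X] (Y : ℕ → Set X) {n m : ℕ}
    (h : n ≤ m) : blockUnion Y n ⊆ blockUnion Y m := fun z hz => by
  obtain ⟨k, hk, hzk⟩ := mem_blockUnion.1 hz
  exact mem_blockUnion.2 ⟨k, hk.trans_le h, hzk⟩

namespace IsStableDecomp

variable {X : Type*} [TopologicalSpace X] {x : X} {Ω : Set X} {Y : ℕ → Set X}

theorem isClopen_blockUnion (hY : IsStableDecomp x Ω Y) (n : ℕ) : IsClopen (blockUnion Y n) :=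
  isClopen_biUnion_finset fun i _ => hY.clopen i

theorem eq_of_mem (hY : IsStableDecomp x Ω Y) {k l : ℕ} {z : X} (hk : z ∈ Y k)
    (hl : z ∈ Y l) : k = l := by
  by_contra h
  exact Set.disjoint_left.1 (hY.disj k l h) hk hl

theorem exists_isOpenEmbedding_add (hY : IsStableDecomp x Ω Y) (k j : ℕ) :
    ∃ f : Y k → Y (k + j), IsOpenEmbedding f := by
  induction j with
  | zero => exact ⟨id, .id⟩
  | succ j ih =>
    obtain ⟨f, hf⟩ := ih
    obtain ⟨Z, hZ, hZc, ⟨e⟩⟩ := hY.contains (k + j)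
    exact ⟨_, (hZc.isOpen.isOpenEmbedding_inclusion hZ).comp (e.isOpenEmbedding.comp hf)⟩

/-- The first `n` pieces embed as an open set in the union of the `n` pieces with indices
`m, …, m + n - 1`. -/
theorem exists_isOpenEmbedding_shift (hY : IsStableDecomp x Ω Y) (n m : ℕ) :
    ∃ g : blockUnion Y n → blockUnion Y (m + n), IsOpenEmbedding g ∧
      ∀ z, (g z : X) ∉ blockUnion Y m := by
  choose f hf using fun k => hY.exists_isOpenEmbedding_add k m
  choose i hin hi using fun z : blockUnion Y n => mem_blockUnion.1 z.2
  let G : blockUnion Y n → X := fun z => f (i z) ⟨z, hi z⟩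
  have hmem : ∀ z, G z ∈ Y (i z + m) := fun z => (f (i z) ⟨z, hi z⟩).2
  have hGf : ∀ (z : blockUnion Y n) k (hk : (z : X) ∈ Y k), G z = f k ⟨z, hk⟩ := by
    intro z k hk
    obtain rfl : i z = k := hY.eq_of_mem (hi z) hk
    rfl
  have hnhds : ∀ z, Filter.map G (𝓝 z) = 𝓝 (G z) := by
    intro z
    have hk : Y (i z) ⊆ blockUnion Y n := fun y hy => mem_blockUnion.2 ⟨i z, hin z, hy⟩
    have h1 := ((hY.clopen (i z)).isOpen.isOpenEmbedding_inclusion hk).map_nhds_eq ⟨z, hi z⟩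
    have h2 := ((hY.clopen (i z + m)).isOpen.isOpenEmbedding_subtypeVal.comp
      (hf (i z))).map_nhds_eq ⟨z, hi z⟩
    have h3 : G ∘ Set.inclusion hk = Subtype.val ∘ f (i z) := funext fun y => hGf _ _ y.2
    rw [← h3, ← Filter.map_map, h1] at h2
    exact h2
  have hinj : Function.Injective G := by
    intro z w hzw
    have hidx : i z = i w := Nat.add_right_cancel (hY.eq_of_mem (hmem z) (hzw ▸ hmem w))
    have := (hf (i z)).injective (Subtype.ext (hzw.trans (hGf w (i z) (hidx ▸ hi w))))
    exact Subtype.ext (Subtype.mk.inj this)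
  have hG : IsOpenEmbedding G := .of_continuous_injective_isOpenMap
    (continuous_iff_continuousAt.2 fun z => (hnhds z).le) hinj
    (IsOpenMap.of_nhds_le fun z => (hnhds z).ge)
  have hmem' : ∀ z, G z ∈ blockUnion Y (m + n) := fun z =>
    mem_blockUnion.2 ⟨i z + m, by have := hin z; omega, hmem z⟩
  refine ⟨fun z => ⟨G z, hmem' z⟩,
    .of_comp _ (hY.isClopen_blockUnion _).isOpen.isOpenEmbedding_subtypeVal hG, ?_⟩
  intro z hz
  obtain ⟨k, hk, hzk⟩ := mem_blockUnion.1 hz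
  have := hY.eq_of_mem hzk (hmem z)
  omega

end IsStableDecomp

/-- Proposition 3.6: any embedding of `Y[n]` onto a clopen subset of `Y[m]` extends to a
self-homeomorphism of `Y[p]` for some `p > m`. (Here `blockUnion Y n` is the union of the
first `n` pieces `Y_1, …, Y_n` of the decomposition.) -/
theorem extend_block_embedding (X : Type*) [TopologicalSpace X] [CompactSpace X]
    [TopologicalSpace.MetrizableSpace X] [TotallyDisconnectedSpace X] [Nonempty X]
    (x : X) (Ω : Set X) (hΩ : IsStableNbhd x Ω) (Y : ℕ → Set X)
    (hY : IsStableDecomp x Ω Y) (n m : ℕ) (hn : 1 ≤ n) (hnm : n < m)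
    (φ : ↥(blockUnion Y n) → ↥(blockUnion Y m))
    (hφ : Topology.IsEmbedding φ) (hcl : IsClopen (Set.range φ)) :
    ∃ p : ℕ, m < p ∧
      ∃ h : ↥(blockUnion Y p) ≃ₜ ↥(blockUnion Y p),
        ∀ (z : ↥(blockUnion Y p)) (hz : (z : X) ∈ blockUnion Y n),
          (↑(h z) : X) = (↑(φ ⟨(z : X), hz⟩) : X) := by
  have := (hY.isClopen_blockUnion n).isClosed.isCompact
  have : CompactSpace (blockUnion Y n) := isCompact_iff_compactSpace.1 this
  obtain ⟨g, hg, hgm⟩ := hY.exists_isOpenEmbedding_shift n m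
  have hι := (hY.isClopen_blockUnion n).isOpen.isOpenEmbedding_inclusion
    (blockUnion_mono Y (Nat.le_add_left n m))
  have hψ := ((hY.isClopen_blockUnion m).isOpen.isOpenEmbedding_inclusion
    (blockUnion_mono Y (Nat.le_add_right m n))).comp ⟨hφ, hcl.isOpen⟩
  obtain ⟨s, hs, -⟩ := exists_homeomorph_of_disjoint_range hι hg
    (isCompact_range hι.continuous).isClosed (isCompact_range hg.continuous).isClosed (by
      rw [Set.disjoint_left]
      rintro _ ⟨a, rfl⟩ ⟨b, hb⟩
      exact hgm b (hb ▸ blockUnion_mono Y hnm.le a.2))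
  obtain ⟨t, -, ht⟩ := exists_homeomorph_of_disjoint_range hψ hg
    (isCompact_range hψ.continuous).isClosed (isCompact_range hg.continuous).isClosed (by
      rw [Set.disjoint_left]
      rintro _ ⟨a, rfl⟩ ⟨b, hb⟩
      exact hgm b (hb ▸ (φ a).2))
  refine ⟨m + n, by omega, s.trans t, fun z hz => ?_⟩
  exact congrArg Subtype.val ((congrArg t (hs ⟨z, hz⟩)).trans (ht ⟨z, hz⟩))
end

section
/- Let X be a second countable Stone space, x ∈ X, and Ω a stable clopen neighborhood of x, with a fixed decomposition Ω \ {x} = ⋃_{k≥1} Y_k as guaranteed by stability, and let B ⊆ Ω be a brick. Then there is a homeomorphism σ : Ω → Ω with σ(x) = x such that the sets σ^i(B), i ∈ ℤ, are pairwise disjoint bricks, and moreover for every point y ∈ Ω \ {x} the σ-orbit {σ^i(y) : i ∈ ℤ} accumulates at x. -/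
open Pointwise Topology

/-- The group of self-homeomorphisms of a space, with `(f * g) x = f (g x)`. -/
instance homeoGroup (X : Type*) [TopologicalSpace X] : Group (X ≃ₜ X) where
  mul f g := g.trans f
  one := Homeomorph.refl X
  inv := Homeomorph.symm
  mul_assoc _ _ _ := Homeomorph.ext fun _ => rfl
  one_mul _ := Homeomorph.ext fun _ => rfl
  mul_one _ := Homeomorph.ext fun _ => rfl
  inv_mul_cancel f := Homeomorph.ext fun x => f.symm_apply_apply x

/-- The compact-open topology on the homeomorphism group. -/
instance homeoTop (X : Type*) [TopologicalSpace X] : TopologicalSpace (X ≃ₜ X) :=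
  TopologicalSpace.induced (fun f : X ≃ₜ X => (f : C(X, X))) ContinuousMap.compactOpen

/-- If `G` is an open embedding onto the punctured clopen set `Ω \ {x}` of a compact Hausdorff
space, then extending a self-homeomorphism of its source by the identity is continuous. -/
lemma continuous_viaEmbedding {X Z : Type*} [TopologicalSpace X] [CompactSpace X] [T2Space X]
    [TopologicalSpace Z] {x : X} {Ω : Set X} (hΩ : IsClopen Ω) (hx : x ∈ Ω) (G : Z ↪ X)
    (hG : IsOpenEmbedding G) (hr : Set.range G = Ω \ {x}) (τ : Z ≃ₜ Z) :
    Continuous (Equiv.Perm.viaEmbedding τ.toEquiv G) := by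
  set e := Equiv.Perm.viaEmbedding τ.toEquiv G
  have heG : ∀ z, e (G z) = G (τ z) := fun z => Equiv.Perm.viaEmbedding_apply _ _ z
  have hoff : ∀ y, y ∉ Set.range G → e y = y := fun y hy =>
    Equiv.Perm.viaEmbedding_apply_of_notMem _ _ y hy
  rw [continuous_iff_continuousAt]
  intro y
  by_cases hy : y ∈ Set.range G
  · obtain ⟨z, rfl⟩ := hy
    rw [← hG.continuousAt_iff]
    have h : e ∘ G = G ∘ τ := funext heG
    rw [h]
    exact (hG.continuous.comp τ.continuous).continuousAt
  by_cases hyx : y = x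
  · subst hyx
    rw [ContinuousAt, hoff y hy]
    refine tendsto_nhds.2 fun U hU hyU => ?_
    have hK : IsCompact (G ⁻¹' (Ω ∩ Uᶜ)) := by
      refine (hG.isInducing.isCompact_preimage_iff ?_).2
        (hΩ.isClosed.inter hU.isClosed_compl).isCompact
      rw [hr]
      rintro w ⟨hw, hwU⟩
      exact ⟨hw, fun h => hwU (by rwa [Set.mem_singleton_iff.1 h])⟩
    have hL := ((hK.image τ.symm.continuous).image hG.continuous).isClosed
    have hyL : y ∉ G '' (τ.symm '' (G ⁻¹' (Ω ∩ Uᶜ))) := fun ⟨z, _, hz⟩ => hy ⟨z, hz⟩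
    filter_upwards [hΩ.isOpen.mem_nhds hx, hL.isOpen_compl.mem_nhds hyL] with w hw hwL
    by_cases hwr : w ∈ Set.range G
    · obtain ⟨z, rfl⟩ := hwr
      rw [Set.mem_preimage, heG]
      by_contra hU'
      have hmem : G (τ z) ∈ Ω \ {y} := hr ▸ Set.mem_range_self _
      exact hwL ⟨z, ⟨τ z, ⟨hmem.1, hU'⟩, τ.symm_apply_apply z⟩, rfl⟩
    · rw [Set.mem_preimage, hoff w hwr]
      rw [hr] at hwr
      have hwy : w = y := by
        by_contra hne
        exact hwr ⟨hw, hne⟩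
      rwa [hwy]
  · have hyΩ : y ∈ Ωᶜ := fun h => hy (hr ▸ ⟨h, hyx⟩)
    refine continuousAt_id.congr ?_
    filter_upwards [hΩ.compl.isOpen.mem_nhds hyΩ] with w hw
    exact (hoff w fun h => hw (hr ▸ h : w ∈ Ω \ {x}).1).symm

/-- A self-homeomorphism of the punctured clopen set `Ω \ {x}` extends by the identity. -/
lemma exists_homeomorph_extending {X Z : Type*} [TopologicalSpace X] [CompactSpace X] [T2Space X]
    [TopologicalSpace Z] {x : X} {Ω : Set X} (hΩ : IsClopen Ω) (hx : x ∈ Ω) {G : Z → X}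
    (hG : IsOpenEmbedding G) (hr : Set.range G = Ω \ {x}) (τ : Z ≃ₜ Z) :
    ∃ σ : X ≃ₜ X, (∀ z, σ (G z) = G (τ z)) ∧ ∀ y, y ∉ Ω \ {x} → σ y = y := by
  let ι : Z ↪ X := ⟨G, hG.injective⟩
  have hsymm : (Equiv.Perm.viaEmbedding τ.toEquiv ι).symm =
      Equiv.Perm.viaEmbedding τ.symm.toEquiv ι :=
    (map_inv (Equiv.Perm.viaEmbeddingHom ι) τ.toEquiv).symm
  refine ⟨⟨Equiv.Perm.viaEmbedding τ.toEquiv ι, continuous_viaEmbedding hΩ hx ι hG hr τ, ?_⟩,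
    fun z => Equiv.Perm.viaEmbedding_apply _ ι z, fun y hy =>
    Equiv.Perm.viaEmbedding_apply_of_notMem _ ι y (hr ▸ hy)⟩
  change Continuous (Equiv.Perm.viaEmbedding τ.toEquiv ι).symm
  rw [hsymm]
  exact continuous_viaEmbedding hΩ hx ι hG hr τ.symm

/-- An infinite coinfinite set of naturals is the zero fibre of a partition of `ℕ` into infinite
sets indexed by `ℤ`. -/
lemma exists_int_coloring {S : Set ℕ} (hS : S.Infinite) (hSc : Sᶜ.Infinite) :
    ∃ c : ℕ → ℤ, c ⁻¹' {0} = S ∧ ∀ i, (c ⁻¹' {i}).Infinite := by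
  classical
  have := hSc.to_subtype
  have : Infinite {i : ℤ // i ≠ 0} := (Set.finite_singleton (0 : ℤ)).infinite_compl.to_subtype
  obtain ⟨e⟩ : Nonempty ({i : ℤ // i ≠ 0} × ℕ ≃ (Sᶜ : Set ℕ)) := nonempty_equiv_of_countable
  let c : ℕ → ℤ := fun k => if h : k ∈ Sᶜ then (e.symm ⟨k, h⟩).1 else 0
  have hc0 : c ⁻¹' {0} = S := by
    ext k
    by_cases h : k ∈ S
    · simp [c, h]
    · simp [c, h, (e.symm ⟨k, h⟩).1.2]
  refine ⟨c, hc0, fun i => ?_⟩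
  by_cases hi : i = 0
  · rw [hi, hc0]
    exact hS
  · refine Set.infinite_of_injective_forall_mem (f := fun n : ℕ => (e (⟨i, hi⟩, n) : ℕ)) ?_ ?_
    · intro m n hmn
      simpa using e.injective (Subtype.ext hmn)
    · intro n
      have h := (e (⟨i, hi⟩, n)).2
      change c _ = i
      simp only [c]
      rw [dif_pos h]
      simp

section StableDecomp

variable {X : Type*} [TopologicalSpace X] {x : X} {Ω : Set X} {Y : ℕ → Set X}

lemma IsStableDecomp.nonempty_homeomorph_biUnion (hY : IsStableDecomp x Ω Y) {S : Set ℕ}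
    (hS : S.Infinite) : Nonempty ((Ω \ {x} : Set X) ≃ₜ (⋃ k ∈ S, Y k : Set X)) := by
  have h := hY.subseq (Nat.nth (· ∈ S)) (Nat.nth_strictMono hS)
  have hr : Set.range (Nat.nth (· ∈ S)) = S := Nat.range_nth_of_infinite hS
  rwa [← Set.biUnion_range (f := Nat.nth (· ∈ S)) (g := Y), hr] at h

lemma IsStableDecomp.eventually_subset (hY : IsStableDecomp x Ω Y) {U : Set X} (hU : U ∈ 𝓝 x) :
    ∀ᶠ k in Filter.atTop, Y k ⊆ U := by
  classical
  have h : ∀ k, ∃ y ∈ Y k, y ∈ U → Y k ⊆ U := fun k => by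
    by_cases hk : Y k ⊆ U
    · obtain ⟨y, hy⟩ := hY.nonempty k
      exact ⟨y, hy, fun _ => hk⟩
    · obtain ⟨y, hy, hyU⟩ := Set.not_subset.1 hk
      exact ⟨y, hy, fun h => absurd h hyU⟩
  choose u hu huU using h
  filter_upwards [hY.descends u hu hU] with k hk
  exact huU k hk

/-- A colouring of the pieces with infinite colour classes identifies the disjoint union of
`ℤ`-many copies of `Ω \ {x}` with `Ω \ {x}`, copies corresponding to colour classes. -/
lemma IsStableDecomp.exists_isOpenEmbedding_sigma (hY : IsStableDecomp x Ω Y) {c : ℕ → ℤ}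
    (hc : ∀ i, (c ⁻¹' {i}).Infinite) :
    ∃ G : (Σ _ : ℤ, (Ω \ {x} : Set X)) → X, IsOpenEmbedding G ∧ Set.range G = Ω \ {x} ∧
      ∀ i, Set.range (fun m => G ⟨i, m⟩) = ⋃ k ∈ c ⁻¹' {i}, Y k := by
  have h : ∀ i, (Ω \ {x} : Set X) ≃ₜ (⋃ k ∈ c ⁻¹' {i}, Y k : Set X) := fun i =>
    (hY.nonempty_homeomorph_biUnion (hc i)).some
  let G : (Σ _ : ℤ, (Ω \ {x} : Set X)) → X := fun z => h z.1 z.2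
  have hrange : ∀ i, Set.range (fun m => G ⟨i, m⟩) = ⋃ k ∈ c ⁻¹' {i}, Y k := fun i => by
    have := (h i).surjective.range_comp (Subtype.val : (⋃ k ∈ c ⁻¹' {i}, Y k : Set X) → X)
    rwa [Subtype.range_coe] at this
  have hmem : ∀ z, ∃ k, c k = z.1 ∧ G z ∈ Y k := fun z => by
    simpa using (h z.1 z.2).2
  have hopen : ∀ i, IsOpen (⋃ k ∈ c ⁻¹' {i}, Y k) := fun i =>
    isOpen_biUnion fun k _ => (hY.clopen k).isOpen
  have hinj : Function.Injective G := by
    rintro ⟨i, m⟩ ⟨j, n⟩ heq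
    obtain ⟨k, hk, hkm⟩ := hmem ⟨i, m⟩
    obtain ⟨l, hl, hln⟩ := hmem ⟨j, n⟩
    have hkl : k = l := by
      by_contra hne
      exact Set.disjoint_left.1 (hY.disj k l hne) hkm (heq ▸ hln)
    obtain rfl : i = j := hk.symm.trans ((congrArg c hkl).trans hl)
    obtain rfl : m = n := (h i).injective (Subtype.ext heq)
    rfl
  refine ⟨G, .of_continuous_injective_isOpenMap
    (continuous_sigma fun i => continuous_subtype_val.comp (h i).continuous) hinj
    (isOpenMap_sigma.2 fun i => (hopen i).isOpenMap_subtype_val.comp (h i).isOpenMap), ?_, hrange⟩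
  refine Eq.trans ?_ hY.union.symm
  ext y
  constructor
  · rintro ⟨z, rfl⟩
    obtain ⟨k, -, hk⟩ := hmem z
    exact Set.mem_iUnion.2 ⟨k, hk⟩
  · intro hy
    obtain ⟨k, hk⟩ := Set.mem_iUnion.1 hy
    have : y ∈ ⋃ l ∈ c ⁻¹' {c k}, Y l := Set.mem_biUnion (Set.mem_preimage.2 rfl) hk
    rw [← hrange] at this
    obtain ⟨m, hm⟩ := this
    exact ⟨_, hm⟩

end StableDecomp

/-- The shift homeomorphism of a disjoint union of `ℤ`-many copies of a space. -/
def sigmaShift (M : Type*) [TopologicalSpace M] : (Σ _ : ℤ, M) ≃ₜ (Σ _ : ℤ, M) where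
  toFun z := ⟨z.1 + 1, z.2⟩
  invFun z := ⟨z.1 - 1, z.2⟩
  left_inv z := by simp
  right_inv z := by simp
  continuous_toFun := continuous_sigma fun i =>
    continuous_sigmaMk (σ := fun _ : ℤ => M) (i := i + 1)
  continuous_invFun := continuous_sigma fun i =>
    continuous_sigmaMk (σ := fun _ : ℤ => M) (i := i - 1)

lemma zpow_apply_of_semiconj_sigmaShift {X M : Type*} [TopologicalSpace X] [TopologicalSpace M]
    {σ : X ≃ₜ X} {G : (Σ _ : ℤ, M) → X} (hσ : ∀ z, σ (G z) = G (sigmaShift M z)) (i j : ℤ)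
    (m : M) : (σ ^ i) (G ⟨j, m⟩) = G ⟨j + i, m⟩ := by
  have hinv : ∀ j, σ⁻¹ (G ⟨j, m⟩) = G ⟨j - 1, m⟩ := fun j => by
    have h : σ (G ⟨j - 1, m⟩) = G ⟨j, m⟩ := by simp [hσ, sigmaShift]
    rw [← h]
    exact σ.symm_apply_apply _
  induction i generalizing j with
  | zero =>
    rw [zpow_zero, add_zero]
    rfl
  | succ i ih =>
    rw [zpow_add_one]
    change (σ ^ (i : ℤ)) (σ (G ⟨j, m⟩)) = _
    rw [hσ]
    refine (ih (j + 1)).trans ?_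
    rw [add_right_comm, add_assoc]
  | pred i ih =>
    rw [zpow_sub_one]
    change (σ ^ (-(i : ℤ))) (σ⁻¹ (G ⟨j, m⟩)) = _
    rw [hinv, ih (j - 1), sub_add_eq_add_sub, add_sub_assoc]

/-- Lemma 3.9: existence of a shift map. For every brick `B` in a stable neighborhood `Ω`
of `x` there is a homeomorphism `σ` supported on `Ω`, fixing `x`, whose integer iterates
move `B` to pairwise disjoint bricks, and whose orbits in `Ω \ {x}` accumulate at `x`. -/
theorem exists_shift_map (X : Type*) [TopologicalSpace X] [CompactSpace X]
    [TopologicalSpace.MetrizableSpace X] [TotallyDisconnectedSpace X] [Nonempty X]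
    (x : X) (Ω : Set X) (hΩ : IsStableNbhd x Ω) (Y : ℕ → Set X)
    (hY : IsStableDecomp x Ω Y) (B : Set X) (hB : IsBrick Y B) :
    ∃ σ : X ≃ₜ X, SuppOn σ Ω ∧ σ x = x ∧
      (∀ i j : ℤ, i ≠ j → Disjoint (⇑(σ ^ i) '' B) (⇑(σ ^ j) '' B)) ∧
      (∀ i : ℤ, IsBrick Y (⇑(σ ^ i) '' B)) ∧
      (∀ y ∈ Ω \ {x}, x ∈ closure (Set.range fun i : ℤ => (σ ^ i) y)) := by
  obtain ⟨S, hS, hSc, rfl⟩ := hB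
  obtain ⟨c, hc0, hc⟩ := exists_int_coloring hS hSc
  obtain ⟨G, hG, hr, hGi⟩ := hY.exists_isOpenEmbedding_sigma hc
  obtain ⟨σ, hσ, hoff⟩ :=
    exists_homeomorph_extending hΩ.1 (mem_of_mem_nhds hΩ.2.1) hG hr (sigmaShift _)
  have hpow := zpow_apply_of_semiconj_sigmaShift hσ
  have himage : ∀ i : ℤ, ⇑(σ ^ i) '' (⋃ k ∈ S, Y k) = ⋃ k ∈ c ⁻¹' {i}, Y k := fun i => by
    rw [← hc0, ← hGi, ← hGi, ← Set.range_comp]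
    simp only [Function.comp_def, hpow, zero_add]
  refine ⟨σ, fun y hy => hoff y fun h => hy h.1, hoff x fun h => h.2 rfl, ?_, ?_, ?_⟩
  · intro i j hij
    rw [himage, himage, Set.disjoint_iUnion₂_left]
    intro k hk
    rw [Set.disjoint_iUnion₂_right]
    rintro l hl
    exact hY.disj k l fun hkl => hij (hk.symm.trans ((congrArg c hkl).trans hl))
  · intro i
    refine ⟨c ⁻¹' {i}, hc i, (hc (i + 1)).mono fun k hk hk' => ?_, himage i⟩
    have h : i + 1 = i := (Set.mem_singleton_iff.1 hk).symm.trans hk'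
    omega
  · intro y hy
    rw [← hr] at hy
    obtain ⟨⟨j, m⟩, rfl⟩ := hy
    have hmem : ∀ n : ℕ, ∃ k, c k = j + n ∧ (σ ^ (n : ℤ)) (G ⟨j, m⟩) ∈ Y k := fun n => by
      have h : G ⟨j + n, m⟩ ∈ ⋃ k ∈ c ⁻¹' {j + (n : ℤ)}, Y k :=
        hGi (j + n) ▸ Set.mem_range_self m
      rw [hpow]
      simpa using h
    choose k hck hk using hmem
    have hkinj : Function.Injective k := fun a b hab => by
      have := (hck a).symm.trans ((congrArg c hab).trans (hck b))
      omega
    rw [mem_closure_iff_nhds]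
    intro U hU
    obtain ⟨n, hn⟩ := (hkinj.nat_tendsto_atTop.eventually (hY.eventually_subset hU)).exists
    exact ⟨_, hn (hk n), n, rfl⟩
end

section
/- Let X be a second countable Stone space, x ∈ X, and Ω a stable clopen neighborhood of x. Then every h ∈ G(Ω) can be written as h = h₁ ∘ h₂ where h₁, h₂ ∈ G(Ω) and each h_i fixes some point of the orbit {g(x) : g ∈ G(Ω)}. -/
open Pointwise Topology

/-- A local homeomorphism moving `a` to `b ≠ a` gives, by swapping two small clopen
neighborhoods, a global homeomorphism moving `a` to `b` supported on any open set containing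
both points. -/
theorem exists_suppOn_apply_eq {X : Type*} [TopologicalSpace X] [CompactSpace X] [T2Space X]
    [TotallyDisconnectedSpace X] (f : OpenPartialHomeomorph X X) {a : X} (ha : a ∈ f.source)
    (hab : f a ≠ a) {O : Set X} (hO : IsOpen O) (haO : a ∈ O) (hbO : f a ∈ O) :
    ∃ s : X ≃ₜ X, SuppOn s O ∧ s a = f a := by
  classical
  obtain ⟨D, E, hD, hE, haD, hbE, hDE⟩ := t2_separation hab.symm
  have hV : IsOpen (f.source ∩ f ⁻¹' (E ∩ O) ∩ (D ∩ O)) :=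
    (f.isOpen_inter_preimage (hE.inter hO)).inter (hD.inter hO)
  obtain ⟨A, hA, haA, hAV⟩ := compact_exists_isClopen_in_isOpen hV
    (show a ∈ _ from ⟨⟨ha, hbE, hbO⟩, haD, haO⟩)
  have hAs : A ⊆ f.source := fun z hz => (hAV hz).1.1
  have hB : IsClopen (f '' A) :=
    ⟨(hA.isClosed.isCompact.image_of_continuousOn (f.continuousOn.mono hAs)).isClosed,
      f.isOpen_image_of_subset_source hA.isOpen hAs⟩
  have hBt : f '' A ⊆ f.target := by
    rintro _ ⟨z, hz, rfl⟩
    exact f.map_source (hAs hz)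
  have hAB : ∀ z ∈ A, f z ∉ A := fun z hz hz' =>
    Set.disjoint_left.1 hDE (hAV hz').2.1 (hAV hz).1.2.1
  let t : X → X := A.piecewise f ((f '' A).piecewise f.symm id)
  have ht₁ : ∀ z ∈ A, t z = f z := fun z hz => Set.piecewise_eq_of_mem _ _ _ hz
  have ht₂ : ∀ z ∈ A, t (f z) = z := fun z hz => by
    simp only [t]
    rw [Set.piecewise_eq_of_notMem _ _ _ (hAB z hz),
      Set.piecewise_eq_of_mem _ _ _ (Set.mem_image_of_mem f hz), f.left_inv (hAs hz)]
  have ht₃ : ∀ z, z ∉ A → z ∉ f '' A → t z = z := fun z hz hz' => by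
    simp only [t]
    rw [Set.piecewise_eq_of_notMem _ _ _ hz, Set.piecewise_eq_of_notMem _ _ _ hz', id]
  have htt : Function.Involutive t := fun z => by
    by_cases hz : z ∈ A
    · rw [ht₁ z hz, ht₂ z hz]
    by_cases hz' : z ∈ f '' A
    · obtain ⟨w, hw, rfl⟩ := hz'
      rw [ht₂ w hw, ht₁ w hw]
    · rw [ht₃ z hz hz', ht₃ z hz hz']
  have htc : Continuous t := by
    refine continuous_piecewise (by simp [hA.frontier_eq]) ?_ (Continuous.continuousOn ?_)
    · rw [hA.isClosed.closure_eq]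
      exact f.continuousOn.mono hAs
    · refine continuous_piecewise (by simp [hB.frontier_eq]) ?_ continuousOn_id
      rw [hB.isClosed.closure_eq]
      exact f.continuousOn_symm.mono hBt
  refine ⟨⟨htt.toPerm, htc, htc⟩, fun z hz => ht₃ z (fun h => hz (hAV h).2.2) ?_, ht₁ a haA⟩
  rintro ⟨w, hw, rfl⟩
  exact hz (hAV hw).1.2.2

/-- Lemma 3.11 (fragmentation at fixed points): every homeomorphism supported on a stable
neighborhood `Ω` of `x` is a product of two homeomorphisms supported on `Ω`, each fixing a
point of the orbit of `x` under homeomorphisms supported on `Ω`. -/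
theorem fragment_fixed_point (X : Type*) [TopologicalSpace X] [CompactSpace X]
    [TopologicalSpace.MetrizableSpace X] [TotallyDisconnectedSpace X] [Nonempty X]
    (x : X) (Ω : Set X) (hΩ : IsStableNbhd x Ω)
    (h : X ≃ₜ X) (hh : SuppOn h Ω) :
    ∃ h₁ h₂ : X ≃ₜ X, SuppOn h₁ Ω ∧ SuppOn h₂ Ω ∧ h = h₁ * h₂ ∧
      (∃ g : X ≃ₜ X, SuppOn g Ω ∧ h₁ (g x) = g x) ∧
      (∃ g : X ≃ₜ X, SuppOn g Ω ∧ h₂ (g x) = g x) := by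
  obtain ⟨hcl, hnhds, hstable⟩ := hΩ
  have hxΩ : x ∈ Ω := mem_of_mem_nhds hnhds
  have one_supp : SuppOn (1 : X ≃ₜ X) Ω := fun _ _ => rfl
  by_cases hx : h x = x
  · exact ⟨h, 1, hh, one_supp, (mul_one h).symm, ⟨1, one_supp, hx⟩, ⟨1, one_supp, rfl⟩⟩
  have hyΩ : h x ∈ Ω := by
    by_contra hy
    exact hx (h.injective (hh _ hy))
  obtain ⟨U, hU, hxU, hUsub⟩ := compact_exists_isClopen_in_isOpen
    (hcl.isOpen.inter (isOpen_compl_singleton (x := h x)))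
    (show x ∈ _ from ⟨hxΩ, fun e => hx (Set.mem_singleton_iff.1 e).symm⟩)
  obtain ⟨Φ, hΦ⟩ := hstable U (fun z hz => (hUsub hz).1) hU (hU.isOpen.mem_nhds hxU)
  -- The stability homeomorphism moves `h x` to a third point `p` of the orbit of `x`.
  obtain ⟨p, hp⟩ : ∃ p : X, p = Φ ⟨h x, hyΩ⟩ := ⟨_, rfl⟩
  have hpU : p ∈ U := hp ▸ (Φ ⟨h x, hyΩ⟩).2
  have hpx : p ≠ x := fun e => hx <| by
    have := Φ.injective (Subtype.ext ((hp.symm.trans e).trans (hΦ hxΩ).symm))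
    exact congrArg Subtype.val this
  have hpy : p ≠ h x := (hUsub hpU).2
  have : Nonempty Ω := ⟨⟨x, hxΩ⟩⟩
  have hi : IsOpenEmbedding (Subtype.val : Ω → X) := hcl.isOpen.isOpenEmbedding_subtypeVal
  have hk : IsOpenEmbedding (Subtype.val ∘ Φ : Ω → X) :=
    hU.isOpen.isOpenEmbedding_subtypeVal.comp Φ.isOpenEmbedding
  let φ : OpenPartialHomeomorph X X := h.toOpenPartialHomeomorph.trans
    ((hi.toOpenPartialHomeomorph _).symm.trans (hk.toOpenPartialHomeomorph _))
  have hφs : x ∈ φ.source := by simp [φ, hyΩ]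
  have hφx : φ x = p := by
    have : (hi.toOpenPartialHomeomorph _).symm (h x) = ⟨h x, hyΩ⟩ :=
      hi.toOpenPartialHomeomorph_left_inv (x := ⟨h x, hyΩ⟩)
    simp [φ, this, hp]
  obtain ⟨g, hg, hgx⟩ := exists_suppOn_apply_eq φ hφs (hφx ▸ hpx) hcl.isOpen hxΩ
    (hφx ▸ (hUsub hpU).1)
  obtain ⟨s, hs, hsx⟩ := exists_suppOn_apply_eq h.toOpenPartialHomeomorph (Set.mem_univ x) hx
    (hcl.isOpen.inter (isOpen_compl_singleton (x := p))) ⟨hxΩ, hpx.symm⟩ ⟨hyΩ, hpy.symm⟩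
  have hsΩ : SuppOn s Ω := fun z hz => hs z fun hz' => hz hz'.1
  refine ⟨s, s⁻¹ * h, hsΩ, fun z hz => ?_, (mul_inv_cancel_left s h).symm,
    ⟨g, hg, ?_⟩, ⟨1, one_supp, ?_⟩⟩
  · change s.symm (h z) = z
    rw [hh z hz, s.symm_apply_eq, hsΩ z hz]
  · rw [hgx, hφx]
    exact hs p fun hp' => hp'.2 rfl
  · change s.symm (h x) = x
    rw [s.symm_apply_eq]
    exact hsx.symm
end

section
/- Let X be a second countable Stone space, x ∈ X, and Ω a stable clopen neighborhood of x, with a fixed decomposition Ω \ {x} = ⋃_{k≥1} Y_k as guaranteed by stability. Then every homeomorphism f of X supported on Ω with f(x) = x can be written as f = g ∘ h, where g and h are homeomorphisms of X fixing x, and each of g and h is supported on B ∪ {x} for some brick B ⊆ Ω. -/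
open Pointwise Topology

/-- Two disjoint open sets: their union is homeomorphic to their sum. -/
theorem exists_homeomorph_sum_union {X : Type*} [TopologicalSpace X] {A B : Set X}
    (hA : IsOpen A) (hB : IsOpen B) (hAB : Disjoint A B) :
    ∃ e : (A ⊕ B) ≃ₜ (A ∪ B : Set X),
      (∀ a : A, (e (Sum.inl a) : X) = a) ∧ ∀ b : B, (e (Sum.inr b) : X) = b := by
  let φ : A ⊕ B → (A ∪ B : Set X) :=
    Sum.elim (Set.inclusion Set.subset_union_left) (Set.inclusion Set.subset_union_right)
  have hc : Continuous φ :=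
    (continuous_inclusion Set.subset_union_left).sumElim
      (continuous_inclusion Set.subset_union_right)
  have ho : IsOpenMap φ :=
    (hA.isOpenMap_inclusion Set.subset_union_left).sumElim
      (hB.isOpenMap_inclusion Set.subset_union_right)
  have hb : Function.Bijective φ := by
    constructor
    · rintro (⟨a, ha⟩ | ⟨a, ha⟩) (⟨b, hb⟩ | ⟨b, hb⟩) h <;>
        obtain rfl : a = b := congrArg Subtype.val h
      · rfl
      · exact (hAB.notMem_of_mem_left ha hb).elim
      · exact (hAB.notMem_of_mem_left hb ha).elim
      · rfl
    · rintro ⟨y, hy | hy⟩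
      · exact ⟨Sum.inl ⟨y, hy⟩, rfl⟩
      · exact ⟨Sum.inr ⟨y, hy⟩, rfl⟩
  exact ⟨(Equiv.ofBijective φ hb).toHomeomorphOfContinuousOpen hc ho,
    fun _ => rfl, fun _ => rfl⟩

/-- Homeomorphisms between disjoint open pieces glue. -/
theorem exists_homeomorph_union_congr {X : Type*} [TopologicalSpace X] {A B A' B' : Set X}
    (hA : IsOpen A) (hB : IsOpen B) (hAB : Disjoint A B)
    (hA' : IsOpen A') (hB' : IsOpen B') (hAB' : Disjoint A' B') (α : A ≃ₜ A') (β : B ≃ₜ B') :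
    ∃ e : (A ∪ B : Set X) ≃ₜ (A' ∪ B' : Set X),
      (∀ y (hy : y ∈ A), (e ⟨y, Or.inl hy⟩ : X) = α ⟨y, hy⟩) ∧
      ∀ y (hy : y ∈ B), (e ⟨y, Or.inr hy⟩ : X) = β ⟨y, hy⟩ := by
  obtain ⟨s, sA, sB⟩ := exists_homeomorph_sum_union hA hB hAB
  obtain ⟨s', sA', sB'⟩ := exists_homeomorph_sum_union hA' hB' hAB'
  refine ⟨s.symm.trans ((α.sumCongr β).trans s'), fun y hy => ?_, fun y hy => ?_⟩
  · have : s.symm ⟨y, Or.inl hy⟩ = Sum.inl ⟨y, hy⟩ := by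
      rw [Homeomorph.symm_apply_eq]; exact Subtype.ext (sA ⟨y, hy⟩).symm
    rw [Homeomorph.trans_apply, this]
    exact sA' _
  · have : s.symm ⟨y, Or.inr hy⟩ = Sum.inr ⟨y, hy⟩ := by
      rw [Homeomorph.symm_apply_eq]; exact Subtype.ext (sB ⟨y, hy⟩).symm
    rw [Homeomorph.trans_apply, this]
    exact sB' _

/-- A union of pairwise disjoint open sets is homeomorphic to their sum. -/
theorem nonempty_homeomorph_sigma_iUnion {X ι : Type*} [TopologicalSpace X] {P : ι → Set X}
    (hP : ∀ i, IsOpen (P i)) (hd : ∀ i j, i ≠ j → Disjoint (P i) (P j)) :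
    Nonempty ((Σ i, P i) ≃ₜ (⋃ i, P i : Set X)) := by
  let φ : (Σ i, P i) → (⋃ i, P i : Set X) :=
    fun p => Set.inclusion (Set.subset_iUnion P p.1) p.2
  have hc : Continuous φ :=
    continuous_sigma fun i => continuous_inclusion (Set.subset_iUnion P i)
  have ho : IsOpenMap φ :=
    isOpenMap_sigma.2 fun i => (hP i).isOpenMap_inclusion (Set.subset_iUnion P i)
  have hb : Function.Bijective φ := by
    constructor
    · rintro ⟨i, a, ha⟩ ⟨j, b, hb⟩ h
      obtain rfl : a = b := congrArg Subtype.val h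
      obtain rfl : i = j := by
        by_contra hij
        exact (hd i j hij).notMem_of_mem_left ha hb
      rfl
    · rintro ⟨y, hy⟩
      obtain ⟨i, hi⟩ := Set.mem_iUnion.1 hy
      exact ⟨⟨i, y, hi⟩, rfl⟩
  exact ⟨(Equiv.ofBijective φ hb).toHomeomorphOfContinuousOpen hc ho⟩

/-- In a compact Hausdorff space, a homeomorphism of the complement of a point extends by fixing
the point. -/
theorem exists_homeomorph_extend_compl_singleton {X : Type*} [TopologicalSpace X]
    [CompactSpace X] [T2Space X] (x : X) (e : ({x}ᶜ : Set X) ≃ₜ ({x}ᶜ : Set X)) :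
    ∃ h : X ≃ₜ X, h x = x ∧ ∀ y (hy : y ∈ ({x}ᶜ : Set X)), h y = e ⟨y, hy⟩ := by
  classical
  let ext (e : ({x}ᶜ : Set X) ≃ₜ ({x}ᶜ : Set X)) (y : X) : X :=
    if hy : y ∈ ({x}ᶜ : Set X) then e ⟨y, hy⟩ else x
  have ext_x (e) : ext e x = x := dif_neg (by simp)
  have ext_ne (e) (y) (hy : y ∈ ({x}ᶜ : Set X)) : ext e y = e ⟨y, hy⟩ := dif_pos hy
  have inv (e) (y) : ext e.symm (ext e y) = y := by
    by_cases hy : y ∈ ({x}ᶜ : Set X)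
    · rw [ext_ne e y hy, ext_ne _ _ (e ⟨y, hy⟩).2]
      simp
    · obtain rfl : y = x := by simpa using hy
      rw [ext_x, ext_x]
  have cont (e) : Continuous (ext e) := by
    refine continuous_iff_continuousAt.2 fun y => ?_
    by_cases hy : y ∈ ({x}ᶜ : Set X)
    · have hon : ContinuousOn (ext e) {x}ᶜ := by
        rw [continuousOn_iff_continuous_domRestrict]
        have : Set.domRestrict {x}ᶜ (ext e) = fun z => (e z : X) := by
          funext z
          exact ext_ne e z z.2
        rw [this]
        fun_prop
      exact hon.continuousAt (isOpen_compl_singleton.mem_nhds hy)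
    · obtain rfl : y = x := by simpa using hy
      intro V hV
      rw [ext_x] at hV
      obtain ⟨V', hV'V, hV', hyV'⟩ := mem_nhds_iff.1 hV
      have hK : IsCompact ((Subtype.val : ({y}ᶜ : Set X) → X) ⁻¹' V'ᶜ) := by
        refine Topology.IsInducing.subtypeVal.isCompact_preimage' hV'.isClosed_compl.isCompact ?_
        rw [Subtype.range_coe]
        rintro z hz rfl
        exact hz hyV'
      have hK' := ((hK.image e.symm.continuous).image continuous_subtype_val).isClosed
      rw [Filter.mem_map]
      refine Filter.mem_of_superset (hK'.isOpen_compl.mem_nhds ?_) ?_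
      · rintro ⟨z, -, hz⟩
        exact z.2 hz
      · intro z hz
        by_contra hzV
        have hzy : z ∈ ({y}ᶜ : Set X) := by
          rintro rfl
          exact hzV (by rw [Set.mem_preimage, ext_x]; exact hV'V hyV')
        refine hz ⟨⟨z, hzy⟩, ⟨e ⟨z, hzy⟩, fun h => hzV (hV'V ?_), by simp⟩, rfl⟩
        rwa [ext_ne e z hzy]
  refine ⟨⟨⟨ext e, ext e.symm, inv e, fun y => ?_⟩, cont e, cont e.symm⟩, ext_x e, ext_ne e⟩
  simpa using inv e.symm y

/-- An infinite sum of copies of a space absorbs one more copy. -/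
theorem nonempty_homeomorph_sum_nat_prod (Z : Type*) [TopologicalSpace Z] :
    Nonempty ((Z ⊕ ℕ × Z) ≃ₜ (ℕ × Z)) := by
  let e : (Unit ⊕ ℕ) ≃ₜ ℕ :=
    (Equiv.sumComm Unit ℕ).trans Equiv.natSumPUnitEquivNat |>.toHomeomorphOfDiscrete
  exact ⟨((Homeomorph.punitProd Z).symm.sumCongr (Homeomorph.refl _)).trans
    (Homeomorph.sumProdDistrib.symm.trans (e.prodCongr (Homeomorph.refl Z)))⟩

/-- A space that is an infinite sum of copies of itself absorbs its summands. -/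
theorem nonempty_homeomorph_sum_of_nat_prod {C D W : Type*} [TopologicalSpace C]
    [TopologicalSpace D] [TopologicalSpace W] (hW : Nonempty (W ≃ₜ (ℕ × W)))
    (hCD : Nonempty ((C ⊕ D) ≃ₜ W)) : Nonempty ((C ⊕ W) ≃ₜ W) := by
  obtain ⟨a⟩ := hW
  obtain ⟨b⟩ := hCD
  obtain ⟨c⟩ := nonempty_homeomorph_sum_nat_prod C
  let d : W ≃ₜ ((ℕ × C) ⊕ (ℕ × D)) :=
    a.trans (((Homeomorph.refl ℕ).prodCongr b.symm).trans Homeomorph.prodSumDistrib)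
  exact ⟨((Homeomorph.refl C).sumCongr d).trans
    ((Homeomorph.sumAssoc C (ℕ × C) (ℕ × D)).symm.trans
      ((c.sumCongr (Homeomorph.refl _)).trans d.symm))⟩

theorem inter_union_union_of_union_eq {X : Type*} {P P' Q Q' W : Set X} (hP : P ∪ P' = W)
    (hQ : Q ∪ Q' = W) : (Q' ∩ P') ∪ (Q ∪ P) = W := by
  ext y
  have hPy := Set.ext_iff.1 hP y
  have hQy := Set.ext_iff.1 hQ y
  simp only [Set.mem_inter_iff, Set.mem_union] at *
  tauto

theorem disjoint_inter_union {X : Type*} {P P' Q Q' : Set X} (hP : Disjoint P P')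
    (hQ : Disjoint Q Q') : Disjoint (Q' ∩ P') (Q ∪ P) :=
  Set.disjoint_union_right.2 ⟨hQ.symm.mono_left Set.inter_subset_left,
    hP.symm.mono_left Set.inter_subset_right⟩

theorem union_inter_union_compl_of_union_eq {X : Type*} {P P' Q Q' Ω : Set X} {x : X}
    (hx : x ∈ Ω) (hP : P ∪ P' = Ω \ {x}) (hQ : Q ∪ Q' = Ω \ {x}) :
    (P ∪ Q' ∩ P') ∪ (Q ∪ Ωᶜ) = {x}ᶜ := by
  have h : (P ∪ Q' ∩ P') ∪ (Q ∪ Ωᶜ) = ((Q' ∩ P') ∪ (Q ∪ P)) ∪ Ωᶜ := by ac_rfl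
  rw [h, inter_union_union_of_union_eq hP hQ]
  ext y
  by_cases hy : y = x
  · simp [hy, hx]
  · simp [hy, em]

/-- The union of the pieces with index in `S`. -/
def indexedUnion {X : Type*} (Y : ℕ → Set X) (S : Set ℕ) : Set X :=
  ⋃ k ∈ S, Y k

theorem indexedUnion_mono {X : Type*} (Y : ℕ → Set X) {S T : Set ℕ} (h : S ⊆ T) :
    indexedUnion Y S ⊆ indexedUnion Y T :=
  Set.biUnion_subset_biUnion_left h

namespace IsStableDecomp

variable {X : Type*} [TopologicalSpace X] {x : X} {Ω : Set X} {Y : ℕ → Set X}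

theorem isOpen_indexedUnion (hY : IsStableDecomp x Ω Y) (S : Set ℕ) : IsOpen (indexedUnion Y S) :=
  _root_.isOpen_biUnion fun k _ => (hY.clopen k).isOpen

theorem disjoint_indexedUnion (hY : IsStableDecomp x Ω Y) {S T : Set ℕ} (h : Disjoint S T) :
    Disjoint (indexedUnion Y S) (indexedUnion Y T) := by
  simp only [indexedUnion, Set.disjoint_iUnion_left, Set.disjoint_iUnion_right]
  intro k hk l hl
  exact hY.disj _ _ (h.ne_of_mem hl hk)

theorem indexedUnion_union_compl (hY : IsStableDecomp x Ω Y) (S : Set ℕ) :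
    indexedUnion Y S ∪ indexedUnion Y Sᶜ = Ω \ {x} := by
  rw [indexedUnion, indexedUnion, ← Set.biUnion_union, Set.union_compl_self, Set.biUnion_univ,
    hY.union]

theorem nonempty_homeomorph_nat_prod (hY : IsStableDecomp x Ω Y) :
    Nonempty ((Ω \ {x} : Set X) ≃ₜ (ℕ × (Ω \ {x} : Set X))) := by
  have hκ (i : ℕ) : StrictMono fun n => Nat.pair i n :=
    fun m n h => Nat.pair_lt_pair_right i h
  have e (i : ℕ) := (hY.subseq _ (hκ i)).some
  obtain ⟨s⟩ := nonempty_homeomorph_sigma_iUnion (P := fun i => ⋃ n, Y (Nat.pair i n))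
    (fun i => isOpen_iUnion fun n => (hY.clopen _).isOpen) (fun i j hij => by
      simp only [Set.disjoint_iUnion_left, Set.disjoint_iUnion_right]
      exact fun m n => hY.disj _ _ fun h => hij (Nat.pair_eq_pair.1 h).1)
  have hU : (⋃ i, ⋃ n, Y (Nat.pair i n)) = Ω \ {x} := by
    rw [hY.union]
    refine subset_antisymm (Set.iUnion₂_subset fun i n => Set.subset_iUnion Y _)
      (Set.iUnion_subset fun k => ?_)
    refine Set.subset_iUnion₂_of_subset k.unpair.1 k.unpair.2 ?_
    rw [Nat.pair_unpair]
  let t : (Σ i : ℕ, (⋃ n, Y (Nat.pair i n) : Set X)) ≃ₜ (Σ _ : ℕ, (Ω \ {x} : Set X)) :=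
    { toEquiv := Equiv.sigmaCongrRight fun i => (e i).symm.toEquiv
      continuous_toFun :=
        continuous_sigma fun i => continuous_sigmaMk.comp (e i).symm.continuous
      continuous_invFun :=
        continuous_sigma fun i => continuous_sigmaMk.comp (e i).continuous }
  let u : (Σ _ : ℕ, (Ω \ {x} : Set X)) ≃ₜ (ℕ × (Ω \ {x} : Set X)) :=
    { toEquiv := Equiv.sigmaEquivProd _ _
      continuous_toFun := continuous_sigma fun i => by
        change Continuous fun z => (i, z)
        fun_prop
      continuous_invFun := continuous_prod_of_discrete_left.2 fun i =>
        continuous_sigmaMk (σ := fun _ : ℕ => (Ω \ {x} : Set X)) (i := i) }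
  exact ⟨(Homeomorph.setCongr hU.symm).trans (s.symm.trans (t.trans u))⟩

/-- A relatively clopen part of `Ω \ {x}` that contains infinitely many pieces is homeomorphic
to `Ω \ {x}`. -/
theorem nonempty_homeomorph_of_superset (hY : IsStableDecomp x Ω Y) {κ : ℕ → ℕ}
    (hκ : StrictMono κ) {C D : Set X} (hC : IsOpen C) (hD : IsOpen D) (hCD : Disjoint C D)
    (hU : C ∪ D = Ω \ {x}) (hκC : indexedUnion Y (Set.range κ) ⊆ C) :
    Nonempty (C ≃ₜ (Ω \ {x} : Set X)) := by
  set T := Set.range κ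
  obtain ⟨w⟩ := hY.subseq κ hκ
  have hT : (⋃ n, Y (κ n)) = indexedUnion Y T := (Set.biUnion_range (g := Y)).symm
  have hsplit := hY.indexedUnion_union_compl T
  have hdisj := hY.disjoint_indexedUnion (disjoint_compl_right : Disjoint T Tᶜ)
  have hE : IsOpen (C ∩ indexedUnion Y Tᶜ) := hC.inter (hY.isOpen_indexedUnion _)
  have hET : Disjoint (C ∩ indexedUnion Y Tᶜ) (indexedUnion Y T) :=
    hdisj.symm.mono_left Set.inter_subset_right
  have hEC : (C ∩ indexedUnion Y Tᶜ) ∪ indexedUnion Y T = C := by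
    rw [Set.inter_union_distrib_right, Set.union_comm (indexedUnion Y Tᶜ), hsplit, ← hU,
      Set.union_eq_left.2 hκC, Set.inter_eq_left]
    exact Set.subset_union_left
  obtain ⟨s, -⟩ := exists_homeomorph_sum_union hE (hY.isOpen_indexedUnion T) hET
  obtain ⟨s', -⟩ := exists_homeomorph_sum_union hE (hD.union (hY.isOpen_indexedUnion T))
    (Set.disjoint_union_right.2 ⟨hCD.mono_left Set.inter_subset_left, hET⟩)
  have hall : (C ∩ indexedUnion Y Tᶜ) ∪ (D ∪ indexedUnion Y T) = Ω \ {x} := by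
    rw [Set.union_left_comm, hEC, Set.union_comm, hU]
  obtain ⟨r⟩ := nonempty_homeomorph_sum_of_nat_prod hY.nonempty_homeomorph_nat_prod
    ⟨s'.trans (Homeomorph.setCongr hall)⟩
  exact ⟨(Homeomorph.setCongr hEC.symm).trans (s.symm.trans
    (((Homeomorph.refl _).sumCongr ((Homeomorph.setCongr hT.symm).trans w.symm)).trans r))⟩

/-- A compact subset of `Ω \ {x}` meets only finitely many pieces. -/
theorem eventually_disjoint (hY : IsStableDecomp x Ω Y) {K : Set X} (hK : IsCompact K)
    (hKΩ : K ⊆ Ω \ {x}) : ∀ᶠ k in Filter.atTop, Disjoint K (Y k) := by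
  obtain ⟨t, ht⟩ := hK.elim_finite_subcover Y (fun k => (hY.clopen k).isOpen)
    (hKΩ.trans hY.union.subset)
  filter_upwards [Filter.eventually_gt_atTop (t.sup id)] with k hk
  refine Set.disjoint_of_subset_left ht ?_
  simp only [Set.disjoint_iUnion_left]
  exact fun i hi => hY.disj _ _ ((Finset.le_sup (f := id) hi).trans_lt hk).ne

/-- A homeomorphism preserving `Ω \ {x}` admits infinitely many pieces that are pairwise
disjoint from each other's images. -/
theorem exists_strictMono_disjoint_image [CompactSpace X] (hY : IsStableDecomp x Ω Y)
    (f : X ≃ₜ X) (hf : f ⁻¹' (Ω \ {x}) = Ω \ {x}) :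
    ∃ a : ℕ → ℕ, StrictMono a ∧ ∀ m n, m ≠ n → Disjoint (f ⁻¹' Y (a m)) (Y (a n)) := by
  have hsub (k : ℕ) : Y k ⊆ Ω \ {x} := hY.union ▸ Set.subset_iUnion Y k
  have hpre (k : ℕ) : ∀ᶠ n in Filter.atTop, Disjoint (f ⁻¹' Y k) (Y n) := by
    refine hY.eventually_disjoint ((hY.clopen k).isClosed.preimage f.continuous).isCompact ?_
    rw [← hf]
    exact Set.preimage_mono (hsub k)
  have himg (k : ℕ) : ∀ᶠ n in Filter.atTop, Disjoint (f ⁻¹' Y n) (Y k) := by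
    have h : ∀ᶠ n in Filter.atTop, Disjoint (f '' Y k) (Y n) := by
      refine hY.eventually_disjoint ((hY.clopen k).isClosed.isCompact.image f.continuous) ?_
      rw [Set.image_subset_iff, hf]
      exact hsub k
    filter_upwards [h] with n hn
    rw [Set.disjoint_left] at hn ⊢
    exact fun y hy hyk => hn ⟨y, hyk, rfl⟩ hy
  obtain ⟨a, -, ha⟩ := exists_seq_of_forall_finset_exists (fun _ : ℕ => True)
    (fun m n => m < n ∧ Disjoint (f ⁻¹' Y m) (Y n) ∧ Disjoint (f ⁻¹' Y n) (Y m))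
    (fun s _ => by
      have : ∀ᶠ n in Filter.atTop, ∀ m ∈ s,
          m < n ∧ Disjoint (f ⁻¹' Y m) (Y n) ∧ Disjoint (f ⁻¹' Y n) (Y m) :=
        (Filter.eventually_all_finset s).2 fun m _ =>
          (Filter.eventually_gt_atTop m).and ((hpre m).and (himg m))
      obtain ⟨n, hn⟩ := this.exists
      exact ⟨n, trivial, hn⟩)
  refine ⟨a, fun m n h => (ha m n h).1, fun m n hmn => ?_⟩
  rcases hmn.lt_or_gt with h | h
  · exact (ha m n h).2.1
  · exact (ha n m h).2.2

/-- There are three infinite disjoint sets of indices such that the preimages of the pieces of the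
first avoid the pieces of the other two. -/
theorem exists_index_sets [CompactSpace X] (hY : IsStableDecomp x Ω Y)
    (f : X ≃ₜ X) (hf : f ⁻¹' (Ω \ {x}) = Ω \ {x}) :
    ∃ (κ : ℕ → ℕ) (T U : Set ℕ), StrictMono κ ∧ T.Infinite ∧ U.Infinite ∧
      Disjoint T (Set.range κ) ∧ Disjoint T U ∧ Disjoint (Set.range κ) U ∧
      Disjoint (f ⁻¹' indexedUnion Y T) (indexedUnion Y (Set.range κ)) ∧
      Disjoint (f ⁻¹' indexedUnion Y T) (indexedUnion Y U) := by
  obtain ⟨a, ha, had⟩ := hY.exists_strictMono_disjoint_image f hf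
  have hinj (i j : ℕ) (hi : i < 3) (hj : j < 3) (hij : i ≠ j) :
      Disjoint (Set.range fun n => a (3 * n + i)) (Set.range fun n => a (3 * n + j)) := by
    rw [Set.disjoint_left]
    rintro _ ⟨m, rfl⟩ ⟨n, h⟩
    have := ha.injective h
    omega
  have hmono (i : ℕ) : StrictMono fun n => a (3 * n + i) := fun m n h => ha (by omega)
  have hdis (j : ℕ) (hj : j < 3) (hj0 : j ≠ 0) :
      Disjoint (f ⁻¹' indexedUnion Y (Set.range (fun n => a (3 * n + 0))))
        (indexedUnion Y (Set.range fun n => a (3 * n + j))) := by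
    simp only [indexedUnion, Set.biUnion_range, Set.preimage_iUnion, Set.disjoint_iUnion_left,
      Set.disjoint_iUnion_right]
    exact fun m n => had _ _ (by omega)
  have hinf (i : ℕ) : (Set.range fun n => a (3 * n + i)).Infinite :=
    Set.infinite_range_of_injective (hmono i).injective
  exact ⟨_, _, _, hmono 1, hinf 0, hinf 2, hinj 0 1 (by omega) (by omega) (by omega),
    hinj 0 2 (by omega) (by omega) (by omega), hinj 1 2 (by omega) (by omega) (by omega),
    hdis 1 (by omega) (by omega), hdis 2 (by omega) (by omega)⟩

end IsStableDecomp

/-- Lemma 3.12 (fragmentation into bricks): every homeomorphism supported on `Ω` fixing `x`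
is a product of two homeomorphisms fixing `x`, each supported on `B ∪ {x}` for a brick `B`. -/
theorem fragment_into_bricks (X : Type*) [TopologicalSpace X] [CompactSpace X]
    [TopologicalSpace.MetrizableSpace X] [TotallyDisconnectedSpace X] [Nonempty X]
    (x : X) (Ω : Set X) (hΩ : IsStableNbhd x Ω) (Y : ℕ → Set X)
    (hY : IsStableDecomp x Ω Y)
    (f : X ≃ₜ X) (hf : SuppOn f Ω) (hfx : f x = x) :
    ∃ g h : X ≃ₜ X, f = g * h ∧ g x = x ∧ h x = x ∧
      (∃ B : Set X, IsBrick Y B ∧ SuppOn g (B ∪ {x})) ∧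
      (∃ B : Set X, IsBrick Y B ∧ SuppOn h (B ∪ {x})) := by
  have hfΩ (y : X) : f y ∈ Ω ↔ y ∈ Ω := by
    by_cases hy : y ∈ Ω
    · refine iff_of_true ?_ hy
      by_contra h
      exact h ((f.injective (hf _ h)).symm ▸ hy)
    · rw [hf y hy]
  have hfW : f ⁻¹' (Ω \ {x}) = Ω \ {x} := by
    ext y
    have : f y = x ↔ y = x := ⟨fun h => f.injective (h.trans hfx.symm), fun h => h ▸ hfx⟩
    simp [hfΩ, this]
  obtain ⟨κ, T, U, hκ, hTi, hUi, hTV, hTU, hVU, hdV, hdU⟩ := hY.exists_index_sets f hfW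
  have hVi := Set.infinite_range_of_injective hκ.injective
  have hZo (S) : IsOpen (indexedUnion Y S) := hY.isOpen_indexedUnion S
  have hZd (S) : Disjoint (indexedUnion Y S) (indexedUnion Y Sᶜ) :=
    hY.disjoint_indexedUnion disjoint_compl_right
  have hZu (S) : indexedUnion Y S ∪ indexedUnion Y Sᶜ = Ω \ {x} := hY.indexedUnion_union_compl S
  have hZV : indexedUnion Y (Set.range κ) ⊆ indexedUnion Y Uᶜ :=
    indexedUnion_mono Y hVU.subset_compl_right
  have hZT : indexedUnion Y T ⊆ indexedUnion Y Uᶜ := indexedUnion_mono Y hTU.subset_compl_right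
  have hZTV : indexedUnion Y (Set.range κ) ⊆ indexedUnion Y Tᶜ :=
    indexedUnion_mono Y hTV.symm.subset_compl_right
  have hZW (S) (y) : y ∈ indexedUnion Y S ∨ y ∈ indexedUnion Y Sᶜ ↔ y ∈ Ω ∧ y ≠ x :=
    Set.ext_iff.1 (hZu S) y
  have hZn (S) (y) (h : y ∈ indexedUnion Y S) : y ∉ indexedUnion Y Sᶜ :=
    (hZd S).notMem_of_mem_left h
  have hfW' (y) : f y ∈ Ω ∧ f y ≠ x ↔ y ∈ Ω ∧ y ≠ x := Set.ext_iff.1 hfW y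
  have hdU' (y) (h : f y ∈ indexedUnion Y T) : y ∉ indexedUnion Y U := hdU.notMem_of_mem_left h
  have hdV' (y) (h : f y ∈ indexedUnion Y T) : y ∉ indexedUnion Y (Set.range κ) :=
    hdV.notMem_of_mem_left h
  have hxΩ : x ∈ Ω := mem_of_mem_nhds hΩ.2.1
  have hpo (S) : IsOpen (f ⁻¹' indexedUnion Y S) := (hZo S).preimage f.continuous
  have hpu : f ⁻¹' indexedUnion Y T ∪ f ⁻¹' indexedUnion Y Tᶜ = Ω \ {x} := by
    rw [← Set.preimage_union, hZu, hfW]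
  obtain ⟨φ⟩ := hY.nonempty_homeomorph_of_superset
    (C := indexedUnion Y Uᶜ ∩ f ⁻¹' indexedUnion Y Tᶜ)
    (D := indexedUnion Y U ∪ f ⁻¹' indexedUnion Y T)
    hκ ((hZo _).inter (hpo _)) ((hZo _).union (hpo _))
    (disjoint_inter_union ((hZd T).preimage f) (hZd U)) (inter_union_union_of_union_eq hpu (hZu U))
    (fun y hy => ⟨hZV hy, by
      have := hdV' y
      have := hZW (Set.range κ) y
      rw [Set.mem_preimage]
      grind⟩)
  obtain ⟨ψ⟩ := hY.nonempty_homeomorph_of_superset (C := indexedUnion Y Uᶜ ∩ indexedUnion Y Tᶜ)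
    (D := indexedUnion Y U ∪ indexedUnion Y T) hκ ((hZo _).inter (hZo _)) ((hZo _).union (hZo _))
    (disjoint_inter_union (hZd T) (hZd U)) (inter_union_union_of_union_eq (hZu T) (hZu U))
    (fun y hy => ⟨hZV hy, hZTV hy⟩)
  obtain ⟨e₁, he₁, -⟩ := exists_homeomorph_union_congr (hpo T) ((hZo Uᶜ).inter (hpo Tᶜ))
    ((hZd T).preimage f |>.mono_right Set.inter_subset_right) (hZo T)
    ((hZo Uᶜ).inter (hZo Tᶜ)) ((hZd T).mono_right Set.inter_subset_right)
    (f.sets rfl) (φ.trans ψ.symm)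
  have hRo : IsOpen (indexedUnion Y U ∪ Ωᶜ) := (hZo U).union hΩ.1.compl.isOpen
  have hsub (y : X) : y ∈ indexedUnion Y Uᶜ → y ∉ indexedUnion Y U ∪ Ωᶜ := by
    simp only [Set.mem_union, Set.mem_compl_iff]
    grind
  obtain ⟨e₂, he₂, he₂'⟩ := exists_homeomorph_union_congr
    ((hpo T).union ((hZo Uᶜ).inter (hpo Tᶜ))) hRo
    (by
      rw [Set.disjoint_left]
      rintro y (hy | hy)
      · refine hsub y ?_
        rw [Set.mem_preimage] at hy
        grind
      · exact hsub y hy.1)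
    ((hZo T).union ((hZo Uᶜ).inter (hZo Tᶜ))) hRo
    (by
      rw [Set.disjoint_left]
      rintro y (hy | hy)
      · exact hsub y (hZT hy)
      · exact hsub y hy.1)
    e₁ (Homeomorph.refl _)
  have hdom : f ⁻¹' indexedUnion Y T ∪ indexedUnion Y Uᶜ ∩ f ⁻¹' indexedUnion Y Tᶜ ∪
      (indexedUnion Y U ∪ Ωᶜ) = {x}ᶜ :=
    union_inter_union_compl_of_union_eq hxΩ hpu (hZu U)
  have hcod : indexedUnion Y T ∪ indexedUnion Y Uᶜ ∩ indexedUnion Y Tᶜ ∪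
      (indexedUnion Y U ∪ Ωᶜ) = {x}ᶜ :=
    union_inter_union_compl_of_union_eq hxΩ (hZu T) (hZu U)
  obtain ⟨h, hhx, hh⟩ := exists_homeomorph_extend_compl_singleton x
    ((Homeomorph.setCongr hdom.symm).trans (e₂.trans (Homeomorph.setCongr hcod)))
  have hhT (y) (hy : f y ∈ indexedUnion Y T) : h y = f y := by
    rw [hh y (hdom ▸ Or.inl (Or.inl hy))]
    refine (he₂ y (Or.inl hy)).trans ?_
    rw [he₁ y hy]
    rfl
  have hhR (y) (hy : y ∈ indexedUnion Y U ∪ Ωᶜ) : h y = y := by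
    rw [hh y (hdom ▸ Or.inr hy)]
    exact he₂' y hy
  have happ (y) : (f * h⁻¹) y = f (h.symm y) := rfl
  refine ⟨f * h⁻¹, h, (inv_mul_cancel_right f h).symm, ?_, hhx,
    ⟨indexedUnion Y Tᶜ, ⟨Tᶜ, ?_, by rwa [compl_compl], rfl⟩, fun y hy => ?_⟩,
    ⟨indexedUnion Y Uᶜ, ⟨Uᶜ, ?_, by rwa [compl_compl], rfl⟩, fun y hy => hhR y ?_⟩⟩
  · rw [happ, h.symm_apply_eq.2 hhx.symm, hfx]
  · exact hVi.mono hTV.subset_compl_left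
  · by_cases hyT : y ∈ indexedUnion Y T
    · have : h.symm y = f.symm y := by
        rw [h.symm_apply_eq, hhT _ (by rwa [f.apply_symm_apply]), f.apply_symm_apply]
      rw [happ, this, f.apply_symm_apply]
    · have hyΩ : y ∉ Ω := by
        simp only [Set.mem_union, Set.mem_singleton_iff] at hy
        grind
      rw [happ, h.symm_apply_eq.2 (hhR y (Or.inr hyΩ)).symm, hf y hyΩ]
  · exact hVi.mono hVU.subset_compl_right
  · simp only [Set.mem_union, Set.mem_singleton_iff, Set.mem_compl_iff] at hy ⊢
    grind
end

section
/- Let X be a second countable Stone space, x ∈ X, and Ω a stable clopen neighborhood of x, with a fixed decomposition Ω \ {x} = ⋃_{k≥1} Y_k as guaranteed by stability. Suppose W ⊆ Homeo(X) is symmetric and Homeo(X) = ⋃_{i∈ℕ} g_i·W for elements g_i ∈ Homeo(X). Let A ⊆ Ω be a brick and A₁, A₂, … pairwise disjoint subbricks of A. Then there exists i ≥ 1 such that: (i) for every homeomorphism h of X supported on A_i ∪ {x} there is an element of g_i·W supported on A ∪ {x} agreeing with h on A_i; and (ii) for every homeomorphism h of X supported on A_i ∪ {x} there is an element of W·W supported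 on A ∪ {x} agreeing with h on A_i. -/
open Pointwise Topology

section Decomposition

variable {X : Type*} [TopologicalSpace X] {x : X} {Ω : Set X} {Y : ℕ → Set X}

lemma IsStableDecomp.notMem_piece (hY : IsStableDecomp x Ω Y) (k : ℕ) : x ∉ Y k := fun hx => by
  have hmem : x ∈ Ω \ {x} := hY.union ▸ Set.mem_iUnion.2 ⟨k, hx⟩
  exact hmem.2 rfl

lemma IsStableDecomp.mem_closure_biUnion (hY : IsStableDecomp x Ω Y) {T : Set ℕ}
    (hT : T.Infinite) : x ∈ closure (⋃ k ∈ T, Y k) := by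
  rw [mem_closure_iff_nhds]
  intro U hU
  obtain ⟨n, hn⟩ := Filter.eventually_atTop.1 (hY.eventually_subset hU)
  obtain ⟨k, hkT, hk⟩ := hT.exists_gt n
  obtain ⟨u, hu⟩ := hY.nonempty k
  exact ⟨u, hn k hk.le hu, Set.mem_biUnion hkT hu⟩

lemma IsStableDecomp.mem_of_mem_biUnion (hY : IsStableDecomp x Ω Y) {T : Set ℕ} {k : ℕ} {y : X}
    (hyk : y ∈ Y k) (hy : y ∈ ⋃ l ∈ T, Y l) : k ∈ T := by
  obtain ⟨l, hl, hyl⟩ := Set.mem_iUnion₂.1 hy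
  by_contra hk
  exact (hY.disj k l fun h => hk (h ▸ hl)).le_bot ⟨hyk, hyl⟩

lemma IsStableDecomp.apply_eq_self [T2Space X] (hY : IsStableDecomp x Ω Y) {T : Set ℕ}
    (hT : T.Infinite) (f : X ≃ₜ X) (hf : ∀ y ∈ ⋃ k ∈ T, Y k, f y = y) : f x = x :=
  closure_minimal hf (isClosed_eq f.continuous continuous_id) (hY.mem_closure_biUnion hT)

lemma IsStableDecomp.suppOn_apply_eq_self [T2Space X] (hY : IsStableDecomp x Ω Y) {T : Set ℕ}
    (hT : Tᶜ.Infinite) {f : X ≃ₜ X} (hf : SuppOn f ((⋃ k ∈ T, Y k) ∪ {x})) : f x = x := by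
  refine hY.apply_eq_self hT f fun y hy => hf y ?_
  obtain ⟨k, hk, hyk⟩ := Set.mem_iUnion₂.1 hy
  rintro (hy' | rfl)
  · exact hk (hY.mem_of_mem_biUnion hyk hy')
  · exact hY.notMem_piece k hyk

/-- Homeomorphisms fixing `x` and preserving disjoint unions of pieces glue to a continuous map
which is the identity elsewhere. -/
lemma IsStableDecomp.exists_continuous_glue (hY : IsStableDecomp x Ω Y) (hΩ : IsClopen Ω)
    (T : ℕ → Set ℕ) (hT : ∀ i j, i ≠ j → Disjoint (T i) (T j)) (h : ℕ → X ≃ₜ X)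
    (hx : ∀ i, h i x = x) (hmaps : ∀ i, ∀ y ∈ ⋃ k ∈ T i, Y k, h i y ∈ ⋃ k ∈ T i, Y k) :
    ∃ f : X → X, Continuous f ∧ (∀ i, ∀ y ∈ ⋃ k ∈ T i, Y k, f y = h i y) ∧
      ∀ y, (∀ i, y ∉ ⋃ k ∈ T i, Y k) → f y = y := by
  classical
  have huniq : ∀ {i j k}, k ∈ T i → k ∈ T j → i = j := by
    intro i j k hi hj
    by_contra hij
    exact (hT i j hij).le_bot ⟨hi, hj⟩
  let f : X → X := fun y => if hy : ∃ i, y ∈ ⋃ k ∈ T i, Y k then h hy.choose y else y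
  have hf : ∀ i, ∀ y ∈ ⋃ k ∈ T i, Y k, f y = h i y := by
    intro i y hy
    have hex : ∃ i, y ∈ ⋃ k ∈ T i, Y k := ⟨i, hy⟩
    obtain ⟨k, hk, hyk⟩ := Set.mem_iUnion₂.1 hy
    have hch : hex.choose = i := huniq (hY.mem_of_mem_biUnion hyk hex.choose_spec) hk
    simp only [f, dif_pos hex, hch]
  have hf' : ∀ y, (∀ i, y ∉ ⋃ k ∈ T i, Y k) → f y = y := fun y hy =>
    dif_neg (not_exists.2 hy)
  have hΩY : ∀ {y i}, y ∈ ⋃ k ∈ T i, Y k → y ∈ Ω \ {x} := by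
    intro y i hy
    obtain ⟨k, -, hyk⟩ := Set.mem_iUnion₂.1 hy
    exact hY.union ▸ Set.mem_iUnion.2 ⟨k, hyk⟩
  refine ⟨f, continuous_iff_continuousAt.2 fun y => ?_, hf, hf'⟩
  by_cases hyx : y = x
  · subst hyx
    have hfy : f y = y := hf' y fun i hy => (hΩY hy).2 rfl
    rw [ContinuousAt, hfy]
    intro U hU
    obtain ⟨n, hn⟩ := Filter.eventually_atTop.1 (hY.eventually_subset hU)
    have hev : ∀ k ∈ Finset.range n, ∀ᶠ z in 𝓝 y, ∀ i, k ∈ T i → h i z ∈ U := by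
      intro k _
      by_cases hk : ∃ i, k ∈ T i
      · obtain ⟨i, hi⟩ := hk
        have hcont : ∀ᶠ z in 𝓝 y, h i z ∈ U :=
          (h i).continuous.continuousAt.eventually_mem ((hx i).symm ▸ hU)
        filter_upwards [hcont] with z hz j hj
        exact huniq hi hj ▸ hz
      · exact Filter.Eventually.of_forall fun z i hi => absurd ⟨i, hi⟩ hk
    change ∀ᶠ z in 𝓝 y, f z ∈ U
    filter_upwards [hU, (Filter.eventually_all_finset _).2 hev] with z hzU hz
    by_cases hzT : ∃ i, z ∈ ⋃ k ∈ T i, Y k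
    · obtain ⟨i, hi⟩ := hzT
      rw [hf i z hi]
      obtain ⟨k, hk, hzk⟩ := Set.mem_iUnion₂.1 (hmaps i z hi)
      by_cases hkn : k < n
      · exact hz k (Finset.mem_range.2 hkn) i hk
      · exact hn k (not_lt.1 hkn) hzk
    · rwa [hf' z (not_exists.1 hzT)]
  · by_cases hyΩ : y ∈ Ω
    · have hyU : y ∈ ⋃ k, Y k := hY.union ▸ ⟨hyΩ, hyx⟩
      obtain ⟨k, hyk⟩ := Set.mem_iUnion.1 hyU
      have hnhds : Y k ∈ 𝓝 y := (hY.clopen k).isOpen.mem_nhds hyk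
      by_cases hk : ∃ i, k ∈ T i
      · obtain ⟨i, hi⟩ := hk
        refine (h i).continuous.continuousAt.congr ?_
        filter_upwards [hnhds] with z hz using (hf i z (Set.mem_biUnion hi hz)).symm
      · refine continuousAt_id.congr ?_
        filter_upwards [hnhds] with z hz
        exact (hf' z fun i hi => hk ⟨i, hY.mem_of_mem_biUnion hz hi⟩).symm
    · refine continuousAt_id.congr ?_
      filter_upwards [hΩ.compl.isOpen.mem_nhds hyΩ] with z hz
      exact (hf' z fun i hi => hz (hΩY hi).1).symm

end Decomposition

lemma SuppOn.symm {X : Type*} [TopologicalSpace X] {f : X ≃ₜ X} {A : Set X} (hf : SuppOn f A) :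
    SuppOn f.symm A := fun y hy => by
  rw [Homeomorph.symm_apply_eq, hf y hy]

lemma SuppOn.apply_mem {X : Type*} [TopologicalSpace X] {x : X} {f : X ≃ₜ X} {A : Set X}
    (hf : SuppOn f (A ∪ {x})) (hfx : f x = x) (hx : x ∉ A) {y : X} (hy : y ∈ A) : f y ∈ A := by
  by_contra hfy
  by_cases h : f y = x
  · exact hx (f.injective (h.trans hfx.symm) ▸ hy)
  · have hfix : f (f y) = f y := hf _ (by rintro (h' | h'); exacts [hfy h', h h'])
    exact hfy ((f.injective hfix).symm ▸ hy)

/-- Homeomorphisms supported on disjoint unions of pieces together with `x` have a common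
extension which is the identity elsewhere. -/
lemma IsStableDecomp.exists_homeomorph_glue {X : Type*} [TopologicalSpace X] [T2Space X] {x : X}
    {Ω : Set X} {Y : ℕ → Set X} (hY : IsStableDecomp x Ω Y) (hΩ : IsClopen Ω)
    (T : ℕ → Set ℕ) (hT : ∀ i j, i ≠ j → Disjoint (T i) (T j)) (hTc : ∀ i, (T i)ᶜ.Infinite)
    (h : ℕ → X ≃ₜ X) (hsupp : ∀ i, SuppOn (h i) ((⋃ k ∈ T i, Y k) ∪ {x})) :
    ∃ f : X ≃ₜ X, (∀ i, ∀ y ∈ ⋃ k ∈ T i, Y k, f y = h i y) ∧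
      ∀ y, (∀ i, y ∉ ⋃ k ∈ T i, Y k) → f y = y := by
  have hfix : ∀ i, h i x = x := fun i => hY.suppOn_apply_eq_self (hTc i) (hsupp i)
  have hfix' : ∀ i, (h i).symm x = x := fun i =>
    hY.suppOn_apply_eq_self (hTc i) (hsupp i).symm
  have hx : ∀ i, x ∉ ⋃ k ∈ T i, Y k := fun i hi => by
    obtain ⟨k, -, hk⟩ := Set.mem_iUnion₂.1 hi
    exact hY.notMem_piece k hk
  have hmaps : ∀ i, ∀ y ∈ ⋃ k ∈ T i, Y k, h i y ∈ ⋃ k ∈ T i, Y k := fun i y hy =>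
    (hsupp i).apply_mem (hfix i) (hx i) hy
  have hmaps' : ∀ i, ∀ y ∈ ⋃ k ∈ T i, Y k, (h i).symm y ∈ ⋃ k ∈ T i, Y k := fun i y hy =>
    (hsupp i).symm.apply_mem (hfix' i) (hx i) hy
  obtain ⟨f, hfc, hf, hf'⟩ := hY.exists_continuous_glue hΩ T hT h hfix hmaps
  obtain ⟨e, hec, he, he'⟩ :=
    hY.exists_continuous_glue hΩ T hT (fun i => (h i).symm) hfix' hmaps'
  refine ⟨⟨⟨f, e, fun y => ?_, fun y => ?_⟩, hfc, hec⟩, hf, hf'⟩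
  · by_cases hy : ∃ i, y ∈ ⋃ k ∈ T i, Y k
    · obtain ⟨i, hi⟩ := hy
      rw [hf i y hi, he i _ (hmaps i y hi), Homeomorph.symm_apply_apply]
    · rw [hf' y (not_exists.1 hy), he' y (not_exists.1 hy)]
  · by_cases hy : ∃ i, y ∈ ⋃ k ∈ T i, Y k
    · obtain ⟨i, hi⟩ := hy
      rw [he i y hi, hf i _ (hmaps' i y hi), Homeomorph.apply_symm_apply]
    · rw [he' y (not_exists.1 hy), hf' y (not_exists.1 hy)]

/-- Lemma 3.14 (diagonal argument): given pairwise disjoint subbricks `As i` of a brick `A`,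
some index `i` is such that every homeomorphism supported on `As i ∪ {x}` extends (agreeing
with it on `As i`) to an element of `g i • W`, respectively of `W * W`, supported on
`A ∪ {x}`. -/
theorem diagonal_argument (X : Type*) [TopologicalSpace X] [CompactSpace X]
    [TopologicalSpace.MetrizableSpace X] [TotallyDisconnectedSpace X] [Nonempty X]
    (x : X) (Ω : Set X) (hΩ : IsStableNbhd x Ω) (Y : ℕ → Set X)
    (hY : IsStableDecomp x Ω Y)
    (W : Set (X ≃ₜ X)) (hsym : W = W⁻¹) (g : ℕ → X ≃ₜ X)
    (hcov : (⋃ i, g i • W) = Set.univ)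
    (A : Set X) (hA : IsBrick Y A) (As : ℕ → Set X)
    (hAs : ∀ i, IsSubbrick Y A (As i))
    (hdisj : ∀ i j, i ≠ j → Disjoint (As i) (As j)) :
    ∃ i : ℕ,
      (∀ h : X ≃ₜ X, SuppOn h (As i ∪ {x}) →
        ∃ f ∈ g i • W, SuppOn f (A ∪ {x}) ∧ ∀ y ∈ As i, f y = h y) ∧
      (∀ h : X ≃ₜ X, SuppOn h (As i ∪ {x}) →
        ∃ f ∈ W * W, SuppOn f (A ∪ {x}) ∧ ∀ y ∈ As i, f y = h y) := by
  have hsub : ∀ i, ∃ T : Set ℕ, T.Infinite ∧ Tᶜ.Infinite ∧ As i = ⋃ k ∈ T, Y k ∧ As i ⊆ A := by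
    intro i
    obtain ⟨S, T, -, hSc, hTS, hTi, -, hAeq, hAi⟩ := hAs i
    refine ⟨T, hTi, hSc.mono (Set.compl_subset_compl.2 hTS), hAi, ?_⟩
    rw [hAeq, hAi]
    exact Set.biUnion_subset_biUnion_left hTS
  choose T hTinf hTc hAT hAsub using hsub
  have hT : ∀ i j, i ≠ j → Disjoint (T i) (T j) := by
    intro i j hij
    refine Set.disjoint_left.2 fun k hi hj => ?_
    obtain ⟨u, hu⟩ := hY.nonempty k
    have hui : u ∈ As i := hAT i ▸ Set.mem_biUnion hi hu
    have huj : u ∈ As j := hAT j ▸ Set.mem_biUnion hj hu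
    exact (hdisj i j hij).le_bot ⟨hui, huj⟩
  have hcoset : ∃ i : ℕ, ∀ h : X ≃ₜ X, SuppOn h (As i ∪ {x}) →
      ∃ f ∈ g i • W, SuppOn f (A ∪ {x}) ∧ ∀ y ∈ As i, f y = h y := by
    by_contra! hcon
    choose h hsupp hbad using hcon
    obtain ⟨f, hf, hf'⟩ := hY.exists_homeomorph_glue hΩ.1 T hT hTc h
      fun i => hAT i ▸ hsupp i
    have hfU : f ∈ ⋃ i, g i • W := hcov ▸ Set.mem_univ f
    obtain ⟨i, hi⟩ := Set.mem_iUnion.1 hfU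
    obtain ⟨y, hy, hne⟩ := hbad i f hi fun y hy =>
      hf' y fun j hj => hy (Or.inl (hAsub j (hAT j ▸ hj)))
    exact hne (hf i y (hAT i ▸ hy))
  obtain ⟨i, hi⟩ := hcoset
  refine ⟨i, hi, fun h hh => ?_⟩
  obtain ⟨f, hfW, hfs, hf⟩ := hi h hh
  obtain ⟨e, heW, hes, he⟩ := hi (Homeomorph.refl X) fun _ _ => rfl
  have hex : e x = x := hY.apply_eq_self (hTinf i) e fun y hy => he y (hAT i ▸ hy)
  have hhx : h x = x := hY.suppOn_apply_eq_self (hTc i) (hAT i ▸ hh)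
  have hxA : x ∉ As i := fun hx => by
    obtain ⟨k, -, hk⟩ := Set.mem_iUnion₂.1 (hAT i ▸ hx : x ∈ ⋃ k ∈ T i, Y k)
    exact hY.notMem_piece k hk
  refine ⟨e⁻¹ * f, ?_, fun y hy => ?_, fun y hy => ?_⟩
  · obtain ⟨w, hw, rfl⟩ := hfW
    obtain ⟨v, hv, rfl⟩ := heW
    refine ⟨v⁻¹, ?_, w, hw, ?_⟩
    · rw [hsym]
      exact Set.inv_mem_inv.2 hv
    · simp only [smul_eq_mul]
      group
  · change e.symm (f y) = y
    rw [hfs y hy, hes.symm y hy]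
  · change e.symm (f y) = h y
    rw [hf y hy, Homeomorph.symm_apply_eq]
    exact (he _ (hh.apply_mem hhx hxA hy)).symm
end

section
/- Let X be a second countable Stone space, x ∈ X, and Ω a stable clopen neighborhood of x, with a fixed decomposition Ω \ {x} = ⋃_{k≥1} Y_k as guaranteed by stability. Suppose W ⊆ Homeo(X) is symmetric and countably many left translates of W cover Homeo(X). Then for every brick A ⊆ Ω there exists a subbrick Z of A such that G(Z) ⊆ W⁸. -/
open Pointwise Topology

open Set Filter

theorem homeo_mul_apply {X : Type*} [TopologicalSpace X] (f g : X ≃ₜ X) (y : X) :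
    (f * g) y = f (g y) := rfl

theorem homeo_inv_apply_self {X : Type*} [TopologicalSpace X] (f : X ≃ₜ X) (y : X) :
    f⁻¹ (f y) = y := f.symm_apply_apply y

theorem homeo_apply_inv_self {X : Type*} [TopologicalSpace X] (f : X ≃ₜ X) (y : X) :
    f (f⁻¹ y) = y := f.apply_symm_apply y

section Support

variable {X : Type*} [TopologicalSpace X]

theorem SuppOn.mono {f : X ≃ₜ X} {A B : Set X} (hf : SuppOn f A) (h : A ⊆ B) : SuppOn f B :=
  fun y hy => hf y fun hA => hy (h hA)

theorem SuppOn.apply_mem_iff {f : X ≃ₜ X} {A : Set X} (hf : SuppOn f A) (y : X) :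
    f y ∈ A ↔ y ∈ A := by
  constructor
  · intro h
    by_contra hy
    exact hy (hf y hy ▸ h)
  · intro h
    by_contra hy
    exact hy ((f.injective (hf _ hy)).symm ▸ h)

theorem SuppOn.inv {f : X ≃ₜ X} {A : Set X} (hf : SuppOn f A) : SuppOn f⁻¹ A := by
  intro y hy
  have h := homeo_inv_apply_self f y
  rwa [hf y hy] at h

theorem SuppOn.mul {f g : X ≃ₜ X} {A : Set X} (hf : SuppOn f A) (hg : SuppOn g A) :
    SuppOn (f * g) A := by
  intro y hy
  rw [homeo_mul_apply, hg y hy, hf y hy]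

/-- A commutator does not change when the two entries are replaced by extensions whose
supports only overlap where nothing new happens. -/
theorem commutator_eq_of_eqOn {B C : Set X} (hCB : C ⊆ B) {a b a' b' : X ≃ₜ X}
    (ha : SuppOn a C) (hb : SuppOn b C) (ha' : EqOn a' a B)
    (hb' : EqOn b' b C) (hb's : SuppOn b' B) :
    a' * b' * a'⁻¹ * b'⁻¹ = a * b * a⁻¹ * b⁻¹ := by
  have hc : SuppOn (a * b * a⁻¹ * b⁻¹) C := ((ha.mul hb).mul ha.inv).mul hb.inv
  have haB := ha.mono hCB
  have hbC : ∀ y, y ∉ C → b' y ∉ C := by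
    intro y hy h
    have hz : b⁻¹ (b' y) ∈ C := (hb.inv.apply_mem_iff _).2 h
    have := hb' hz
    rw [homeo_apply_inv_self] at this
    exact hy (b'.injective this ▸ hz)
  have haB' : ∀ y, y ∉ B → a' y ∉ B := by
    intro y hy h
    have hz : a⁻¹ (a' y) ∈ B := (haB.inv.apply_mem_iff _).2 h
    have := ha' hz
    rw [homeo_apply_inv_self] at this
    exact hy (a'.injective this ▸ hz)
  suffices h : a' * b' = a * b * a⁻¹ * b⁻¹ * (b' * a') by rw [h]; group
  ext y
  rw [homeo_mul_apply, homeo_mul_apply, homeo_mul_apply b' a']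
  by_cases hy : y ∈ C
  · rw [ha' (hCB hy), hb' hy, hb' ((ha.apply_mem_iff y).2 hy),
      ha' (hCB ((hb.apply_mem_iff y).2 hy))]
    have h : a * b = a * b * a⁻¹ * b⁻¹ * (b * a) := by group
    exact congrArg (fun f : X ≃ₜ X => f y) h
  by_cases hyB : y ∈ B
  · rw [ha' hyB, ha y hy, ha' ((hb's.apply_mem_iff y).2 hyB), ha _ (hbC y hy),
      hc _ (hbC y hy)]
  · rw [hb's y hyB, hb's _ (haB' y hyB), hc _ fun h => haB' y hyB (hCB h)]

end Support

section Extension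

variable {X N : Type*} [TopologicalSpace X] [TopologicalSpace N]

/-- A homeomorphism of an open subset with a single boundary point extends by the identity. -/
theorem exists_homeo_extending [CompactSpace X] [T2Space X] {x : X} {e : N → X}
    (he : IsOpenEmbedding e) (hx : x ∉ range e) (hcl : IsClosed (insert x (range e)))
    (φ : N ≃ₜ N) :
    ∃ f : X ≃ₜ X, SuppOn f (range e) ∧ ∀ n, f (e n) = e (φ n) := by
  classical
  let f : Equiv.Perm X := Equiv.Perm.viaEmbedding φ.toEquiv ⟨e, he.injective⟩
  have hfe : ∀ n, f (e n) = e (φ n) := fun n =>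
    Equiv.Perm.viaEmbedding_apply φ.toEquiv ⟨e, he.injective⟩ n
  have hfo : ∀ y, y ∉ range e → f y = y := fun y hy =>
    Equiv.Perm.viaEmbedding_apply_of_notMem φ.toEquiv ⟨e, he.injective⟩ y hy
  have hf : Continuous f := by
    rw [continuous_iff_continuousAt]
    intro y
    by_cases hy : y ∈ range e
    · obtain ⟨n, rfl⟩ := hy
      rw [← he.continuousAt_iff]
      have : f ∘ e = e ∘ φ := funext hfe
      rw [this]
      exact (he.continuous.comp φ.continuous).continuousAt
    by_cases hyx : y = x
    · subst hyx
      rw [ContinuousAt, hfo y hy, tendsto_def]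
      intro V hV
      obtain ⟨U, hUV, hU, hyU⟩ := mem_nhds_iff.1 hV
      have hK : IsCompact (Uᶜ ∩ insert y (range e)) :=
        (hU.isClosed_compl.inter hcl).isCompact
      have hKr : Uᶜ ∩ insert y (range e) ⊆ range e := by
        rintro z ⟨hzU, rfl | hz⟩
        · exact absurd hyU hzU
        · exact hz
      have hL : IsCompact (e '' (φ ⁻¹' (e ⁻¹' (Uᶜ ∩ insert y (range e))))) :=
        (φ.isCompact_preimage.2 ((he.isInducing.isCompact_preimage_iff hKr).2 hK)).image
          he.continuous
      have hyL : y ∉ e '' (φ ⁻¹' (e ⁻¹' (Uᶜ ∩ insert y (range e)))) := fun h =>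
        hy (image_subset_range _ _ h)
      filter_upwards [hL.isClosed.isOpen_compl.mem_nhds hyL, hU.mem_nhds hyU] with z hz hzU
      apply hUV
      by_cases hze : z ∈ range e
      · obtain ⟨n, rfl⟩ := hze
        rw [hfe]
        by_contra hn
        exact hz ⟨n, ⟨hn, mem_insert_of_mem _ ⟨_, rfl⟩⟩, rfl⟩
      · rwa [hfo z hze]
    · have hy' : y ∉ insert x (range e) := by simp [hyx, hy]
      have : f =ᶠ[𝓝 y] id := by
        filter_upwards [hcl.isOpen_compl.mem_nhds hy'] with z hz
        exact hfo z fun h => hz (mem_insert_of_mem _ h)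
      exact continuousAt_id.congr this.symm
  exact ⟨hf.homeoOfEquivCompactToT2, hfo, hfe⟩

/-- A homeomorphism preserving the range of an embedding restricts to its domain. -/
theorem exists_homeo_restricting {e : N → X} (he : IsEmbedding e) {f : X ≃ₜ X}
    (hf : ∀ y, f y ∈ range e ↔ y ∈ range e) :
    ∃ φ : N ≃ₜ N, ∀ n, e (φ n) = f (e n) := by
  have h1 : ∀ n, ∃ k, e k = f (e n) := fun n => (hf _).2 ⟨n, rfl⟩
  have h2 : ∀ n, ∃ k, e k = f.symm (e n) := fun n => (hf _).1 ⟨n, by simp⟩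
  choose p hp using h1
  choose q hq using h2
  refine ⟨⟨⟨p, q, fun n => he.injective ?_, fun n => he.injective ?_⟩, ?_, ?_⟩, hp⟩
  · rw [hq, hp, f.symm_apply_apply]
  · rw [hp, hq, f.apply_symm_apply]
  · refine he.isInducing.continuous_iff.2 ?_
    exact (f.continuous.comp he.continuous).congr fun n => (hp n).symm
  · refine he.isInducing.continuous_iff.2 ?_
    exact (f.symm.continuous.comp he.continuous).congr fun n => (hq n).symm

end Extension

section Sigma

variable {ι M : Type*} [TopologicalSpace M]

/-- A family of homeomorphisms acting fibrewise on copies of `M`. -/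
def fiberHomeo (φ : ι → M ≃ₜ M) : ((_ : ι) × M) ≃ₜ ((_ : ι) × M) where
  toFun p := ⟨p.1, φ p.1 p.2⟩
  invFun p := ⟨p.1, (φ p.1).symm p.2⟩
  left_inv p := by simp
  right_inv p := by simp
  continuous_toFun := continuous_sigma fun i => continuous_sigmaMk.comp (φ i).continuous
  continuous_invFun := continuous_sigma fun i => continuous_sigmaMk.comp (φ i).symm.continuous

/-- The homeomorphism permuting copies of `M`. -/
def permHomeo (σ : Equiv.Perm ι) : ((_ : ι) × M) ≃ₜ ((_ : ι) × M) where
  toFun p := ⟨σ p.1, p.2⟩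
  invFun p := ⟨σ.symm p.1, p.2⟩
  left_inv p := by simp
  right_inv p := by simp
  continuous_toFun := continuous_sigma fun i =>
    continuous_sigmaMk (σ := fun _ : ι => M) (i := σ i)
  continuous_invFun := continuous_sigma fun i =>
    continuous_sigmaMk (σ := fun _ : ι => M) (i := σ.symm i)

variable {X : Type*} [TopologicalSpace X] [CompactSpace X] [T2Space X] {x : X}

/-- If countably many translates of `W` cover the group, then on one of the countably many
copies of `M` every homeomorphism is induced by an element of `W ^ 2`. -/
theorem exists_copy_full {e : (_ : ℕ) × M → X} (he : IsOpenEmbedding e) (hx : x ∉ range e)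
    (hcl : IsClosed (insert x (range e))) {W : Set (X ≃ₜ X)} (hsym : W = W⁻¹)
    {g : ℕ → X ≃ₜ X} (hcov : (⋃ i, g i • W) = univ) :
    ∃ n, ∀ φ : M ≃ₜ M, ∃ w ∈ W ^ 2, SuppOn w (range e) ∧ ∀ m, w (e ⟨n, m⟩) = e ⟨n, φ m⟩ := by
  have key : ∃ n, ∀ φ : M ≃ₜ M, ∃ w ∈ W, SuppOn (g n * w) (range e) ∧
      ∀ m, (g n * w) (e ⟨n, m⟩) = e ⟨n, φ m⟩ := by
    by_contra! hcon
    choose φ hφ using hcon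
    obtain ⟨f, hfs, hf⟩ := exists_homeo_extending he hx hcl (fiberHomeo φ)
    have hfW : f ∈ ⋃ i, g i • W := hcov ▸ mem_univ f
    obtain ⟨n, w, hw, rfl⟩ := mem_iUnion.1 hfW
    obtain ⟨m, hm⟩ := hφ n w hw hfs
    exact hm (hf ⟨n, m⟩)
  obtain ⟨n, hn⟩ := key
  refine ⟨n, fun φ => ?_⟩
  obtain ⟨v, hv, hvs, hve⟩ := hn (Homeomorph.refl M)
  obtain ⟨w, hw, hws, hwe⟩ := hn φ
  have hvw : v⁻¹ * w = (g n * v)⁻¹ * (g n * w) := by group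
  refine ⟨v⁻¹ * w, ?_, ?_, fun m => ?_⟩
  · rw [pow_two]
    exact mul_mem_mul (by rw [hsym]; exact inv_mem_inv.2 hv) hw
  · rw [hvw]
    exact hvs.inv.mul hws
  · have h := homeo_inv_apply_self (g n * v) (e ⟨n, φ m⟩)
    rw [hve] at h
    rw [hvw, homeo_mul_apply, hwe]
    exact h

/-- With a bi-infinite sequence of copies of `M` available, every homeomorphism supported on
the copy of index `0` is a commutator. -/
theorem exists_commutator_of_copies {e : (_ : ℤ) × M → X} (he : IsOpenEmbedding e)
    (hx : x ∉ range e) (hcl : IsClosed (insert x (range e))) {h : X ≃ₜ X}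
    (hh : SuppOn h (range fun m => e ⟨0, m⟩)) :
    ∃ a b : X ≃ₜ X, SuppOn a (range e) ∧ SuppOn b (range e) ∧ h = a * b * a⁻¹ * b⁻¹ := by
  have he0 : IsOpenEmbedding fun m => e ⟨0, m⟩ := he.comp .sigmaMk
  obtain ⟨φ, hφ⟩ := exists_homeo_restricting he0.isEmbedding hh.apply_mem_iff
  obtain ⟨a, has, ha⟩ := exists_homeo_extending he hx hcl
    (fiberHomeo fun i : ℤ => if 0 ≤ i then φ else Homeomorph.refl M)
  obtain ⟨b, hbs, hb⟩ := exists_homeo_extending he hx hcl (permHomeo (Equiv.addRight (1 : ℤ)))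
  refine ⟨a, b, has, hbs, ?_⟩
  replace ha : ∀ i m, a (e ⟨i, m⟩) =
      e ⟨i, (if 0 ≤ i then φ else Homeomorph.refl M) m⟩ := fun i m => ha ⟨i, m⟩
  replace hb : ∀ i m, b (e ⟨i, m⟩) = e ⟨i + 1, m⟩ := fun i m => hb ⟨i, m⟩
  have hhs : SuppOn h (range e) := hh.mono (range_subset_iff.2 fun m => ⟨_, rfl⟩)
  suffices H : h * (b * a) = a * b by
    rw [← H]; group
  ext y
  simp only [homeo_mul_apply]
  by_cases hy : y ∈ range e
  · obtain ⟨⟨i, m⟩, rfl⟩ := hy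
    rw [ha, hb, hb, ha]
    by_cases hi : i + 1 = 0
    · have hi' : ¬ 0 ≤ i := by omega
      rw [hi, if_neg hi', if_pos le_rfl, hφ]
      rfl
    · rw [hh]
      · have : (0 ≤ i) ↔ (0 ≤ i + 1) := by omega
        simp only [this]
      · rintro ⟨k, hk⟩
        exact hi (congrArg Sigma.fst (he.injective hk)).symm
  · rw [has y hy, hbs y hy, has y hy, hhs y hy]

end Sigma

section Bricks

/-- The union of the pieces with index in `S`. -/
def pieces {X : Type*} (Y : ℕ → Set X) (S : Set ℕ) : Set X := ⋃ k ∈ S, Y k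

theorem mem_pieces {X : Type*} {Y : ℕ → Set X} {S : Set ℕ} {y : X} : y ∈ pieces Y S ↔ ∃ k ∈ S, y ∈ Y k := by
  simp [pieces]

theorem pieces_mono {X : Type*} {Y : ℕ → Set X} {S T : Set ℕ} (h : S ⊆ T) : pieces Y S ⊆ pieces Y T :=
  biUnion_subset_biUnion_left h

namespace IsStableDecomp

variable {X : Type*} [TopologicalSpace X] {x : X} {Ω : Set X} {Y : ℕ → Set X}

theorem isOpen_pieces (hY : IsStableDecomp x Ω Y) (S : Set ℕ) : IsOpen (pieces Y S) :=
  isOpen_biUnion fun k _ => (hY.clopen k).isOpen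

theorem notMem_pieces (hY : IsStableDecomp x Ω Y) (S : Set ℕ) : x ∉ pieces Y S := by
  intro h
  obtain ⟨k, -, hk⟩ := mem_pieces.1 h
  have : x ∈ Ω \ {x} := hY.union ▸ mem_iUnion.2 ⟨k, hk⟩
  exact this.2 rfl

theorem eventually_subset_s15 (hY : IsStableDecomp x Ω Y) {V : Set X} (hV : V ∈ 𝓝 x) :
    ∀ᶠ k in atTop, Y k ⊆ V := by
  have h : ∀ k, ∃ u ∈ Y k, u ∈ V → Y k ⊆ V := by
    intro k
    by_cases hk : Y k ⊆ V
    · obtain ⟨u, hu⟩ := hY.nonempty k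
      exact ⟨u, hu, fun _ => hk⟩
    · obtain ⟨u, hu, huV⟩ := not_subset.1 hk
      exact ⟨u, hu, fun h => absurd h huV⟩
  choose u hu huV using h
  filter_upwards [hY.descends u hu hV] with k hk using huV k hk

theorem isClosed_insert_pieces [T2Space X] (hY : IsStableDecomp x Ω Y) (S : Set ℕ) :
    IsClosed (insert x (pieces Y S)) := by
  rw [← isOpen_compl_iff, isOpen_iff_mem_nhds]
  intro y hy
  rw [mem_compl_iff, mem_insert_iff, not_or] at hy
  obtain ⟨U, V, hU, hV, hyU, hxV, hUV⟩ := t2_separation hy.1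
  obtain ⟨K, hK⟩ := eventually_atTop.1 (hY.eventually_subset_s15 (hV.mem_nhds hxV))
  have hfin : ∀ᶠ z in 𝓝 y, ∀ k ∈ Set.Iio K, k ∈ S → z ∉ Y k := by
    rw [eventually_all_finite (finite_Iio K)]
    intro k _
    by_cases hk : k ∈ S
    · filter_upwards [(hY.clopen k).isClosed.isOpen_compl.mem_nhds
        fun h => hy.2 (mem_pieces.2 ⟨k, hk, h⟩)] with z hz _ using hz
    · exact Eventually.of_forall fun _ h => absurd h hk
  filter_upwards [hfin, hU.mem_nhds hyU] with z hz hzU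
  rintro (rfl | h)
  · exact disjoint_left.1 hUV hzU hxV
  · obtain ⟨k, hkS, hk⟩ := mem_pieces.1 h
    rcases lt_or_ge k K with hkK | hkK
    · exact hz k hkK hkS hk
    · exact disjoint_left.1 hUV hzU (hK k hkK hk)

theorem suppOn_pieces [T2Space X] (hY : IsStableDecomp x Ω Y) {S : Set ℕ} (hS : Sᶜ.Infinite)
    {f : X ≃ₜ X} (hf : SuppOn f (pieces Y S ∪ {x})) : SuppOn f (pieces Y S) := by
  choose u hu using hY.nonempty
  have hκ : Tendsto (Nat.nth (· ∈ Sᶜ)) atTop atTop := (Nat.nth_strictMono hS).tendsto_atTop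
  have hux := (hY.descends u hu).comp hκ
  have hfx : f x = x := by
    refine tendsto_nhds_unique ((f.continuous.tendsto x).comp hux) (hux.congr fun n => ?_)
    refine (hf _ ?_).symm
    have hn : Nat.nth (· ∈ Sᶜ) n ∈ Sᶜ := Nat.nth_mem_of_infinite hS n
    have huY : u (Nat.nth (· ∈ Sᶜ) n) ∈ Y (Nat.nth (· ∈ Sᶜ) n) := hu _
    rintro (h | h)
    · obtain ⟨k, hkS, hk⟩ := mem_pieces.1 h
      refine disjoint_left.1 (hY.disj _ k ?_) huY hk
      rintro rfl
      exact hn hkS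
    · refine hY.notMem_pieces univ (mem_pieces.2 ⟨Nat.nth (· ∈ Sᶜ) n, mem_univ _, ?_⟩)
      rwa [← mem_singleton_iff.1 h]
  intro y hy
  by_cases hyx : y = x
  · rw [hyx, hfx]
  · exact hf y fun h => h.elim hy hyx

theorem nonempty_homeo_pieces (hY : IsStableDecomp x Ω Y) {S : Set ℕ} (hS : S.Infinite) :
    Nonempty ((Ω \ {x} : Set X) ≃ₜ pieces Y S) := by
  have h := hY.subseq (Nat.nth (· ∈ S)) (Nat.nth_strictMono hS)
  have hU : (⋃ n, Y (Nat.nth (· ∈ S) n)) = pieces Y S := by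
    have hr : range (Nat.nth (· ∈ S)) = S := Nat.range_nth_of_infinite hS
    rw [pieces, ← biUnion_range (f := Nat.nth (· ∈ S)) (g := Y), hr]
  rwa [hU] at h

/-- Every infinite union of pieces consists of infinitely many disjoint copies of `Ω \ {x}`,
each of which is again an infinite union of pieces. -/
theorem exists_copies (hY : IsStableDecomp x Ω Y) (ι : Type*) [Denumerable ι] {S : Set ℕ}
    (hS : S.Infinite) :
    ∃ e : (_ : ι) × (Ω \ {x} : Set X) → X, IsOpenEmbedding e ∧ range e = pieces Y S ∧
      ∀ i, ∃ T ⊆ S, T.Infinite ∧ (S \ T).Infinite ∧ range (fun m => e ⟨i, m⟩) = pieces Y T := by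
  have : Infinite S := hS.to_subtype
  obtain ⟨d⟩ : Nonempty (ι × ℕ ≃ S) :=
    ⟨(Denumerable.eqv (ι × ℕ)).trans (Nat.Subtype.orderIsoOfNat S).toEquiv⟩
  let T : ι → Set ℕ := fun i => range fun n => (d (i, n) : ℕ)
  have hTS : ∀ i, T i ⊆ S := fun i => range_subset_iff.2 fun n => (d (i, n)).2
  have hTinf : ∀ i, (T i).Infinite := fun i =>
    infinite_range_of_injective fun m n h => by simpa using d.injective (Subtype.ext h)
  have hTdisj : ∀ i j k, k ∈ T i → k ∈ T j → i = j := by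
    rintro i j _ ⟨m, rfl⟩ ⟨n, h⟩
    exact (congrArg Prod.fst (d.injective (Subtype.ext h))).symm
  have : ∀ i, Nonempty ((Ω \ {x} : Set X) ≃ₜ pieces Y (T i)) := fun i =>
    hY.nonempty_homeo_pieces (hTinf i)
  obtain ⟨c⟩ : Nonempty (∀ i, (Ω \ {x} : Set X) ≃ₜ pieces Y (T i)) := Classical.nonempty_pi.2 this
  have hc : ∀ i, range (fun m => (c i m : X)) = pieces Y (T i) := fun i => by
    rw [show (fun m => (c i m : X)) = Subtype.val ∘ c i from rfl, range_comp,
      (c i).surjective.range_eq, image_univ, Subtype.range_coe]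
  refine ⟨fun p => c p.1 p.2, ?_, ?_, fun i => ⟨T i, hTS i, hTinf i, ?_, hc i⟩⟩
  · refine .of_continuous_injective_isOpenMap ?_ ?_ ?_
    · exact continuous_sigma fun i => continuous_subtype_val.comp (c i).continuous
    · rintro ⟨i, m⟩ ⟨j, n⟩ h
      obtain ⟨k, hk, hk'⟩ := mem_pieces.1 (c i m).2
      obtain ⟨l, hl, hl'⟩ := mem_pieces.1 (c j n).2
      have hkl : k = l := by
        by_contra hne
        have h' : (c i m : X) = c j n := h
        exact disjoint_left.1 (hY.disj k l hne) hk' (h' ▸ hl')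
      obtain rfl := hTdisj i j k hk (hkl ▸ hl)
      obtain rfl : m = n := (c i).injective (Subtype.ext h)
      rfl
    · exact isOpenMap_sigma.2 fun i =>
        (hY.isOpen_pieces (T i)).isOpenMap_subtype_val.comp (c i).isOpenMap
  · ext y
    constructor
    · rintro ⟨⟨i, m⟩, rfl⟩
      exact pieces_mono (hTS i) (c i m).2
    · intro hy
      obtain ⟨k, hk, hky⟩ := mem_pieces.1 hy
      obtain ⟨⟨i, n⟩, hin⟩ := d.surjective ⟨k, hk⟩
      have hyT : y ∈ pieces Y (T i) := mem_pieces.2 ⟨k, ⟨n, by simp [hin]⟩, hky⟩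
      exact ⟨⟨i, (c i).symm ⟨y, hyT⟩⟩, by simp⟩
  · obtain ⟨j, hj⟩ := exists_ne i
    exact (hTinf j).mono fun k hk => ⟨hTS j hk, fun h => hj (hTdisj j i k hk h)⟩

variable [CompactSpace X] [T2Space X]

theorem exists_subset_full (hY : IsStableDecomp x Ω Y) {S : Set ℕ} (hS : S.Infinite)
    {W : Set (X ≃ₜ X)} (hsym : W = W⁻¹) {g : ℕ → X ≃ₜ X} (hcov : (⋃ i, g i • W) = univ) :
    ∃ T ⊆ S, T.Infinite ∧ ∀ a : X ≃ₜ X, SuppOn a (pieces Y T) →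
      ∃ w ∈ W ^ 2, SuppOn w (pieces Y S) ∧ EqOn w a (pieces Y T) := by
  obtain ⟨e, he, hr, hT⟩ := hY.exists_copies ℕ hS
  obtain ⟨n, hn⟩ := exists_copy_full he (hr ▸ hY.notMem_pieces S)
    (hr ▸ hY.isClosed_insert_pieces S) hsym hcov
  obtain ⟨T, hTS, hTinf, -, hTr⟩ := hT n
  refine ⟨T, hTS, hTinf, fun a ha => ?_⟩
  rw [← hTr] at ha
  have hen : IsOpenEmbedding fun m => e ⟨n, m⟩ := he.comp .sigmaMk
  obtain ⟨φ, hφ⟩ := exists_homeo_restricting hen.isEmbedding ha.apply_mem_iff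
  obtain ⟨w, hw, hws, hwe⟩ := hn φ
  refine ⟨w, hw, hr ▸ hws, ?_⟩
  rw [← hTr]
  rintro _ ⟨m, rfl⟩
  exact (hwe m).trans (hφ m)

theorem exists_subset_commutator (hY : IsStableDecomp x Ω Y) {S : Set ℕ} (hS : S.Infinite) :
    ∃ T ⊆ S, T.Infinite ∧ (S \ T).Infinite ∧ ∀ f : X ≃ₜ X, SuppOn f (pieces Y T) →
      ∃ a b : X ≃ₜ X, SuppOn a (pieces Y S) ∧ SuppOn b (pieces Y S) ∧
        f = a * b * a⁻¹ * b⁻¹ := by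
  obtain ⟨e, he, hr, hT⟩ := hY.exists_copies ℤ hS
  obtain ⟨T, hTS, hTinf, hST, hTr⟩ := hT 0
  refine ⟨T, hTS, hTinf, hST, fun f hf => ?_⟩
  rw [← hr]
  exact exists_commutator_of_copies he (hr ▸ hY.notMem_pieces S)
    (hr ▸ hY.isClosed_insert_pieces S) (hTr ▸ hf)

end IsStableDecomp

end Bricks

/-- Lemma 3.15: if `W` is symmetric and countably many left translates of `W` cover
`Homeo(X)`, then every brick `A` has a subbrick `Z` with `G(Z) ⊆ W ^ 8`. -/
theorem good_subbrick (X : Type*) [TopologicalSpace X] [CompactSpace X]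
    [TopologicalSpace.MetrizableSpace X] [TotallyDisconnectedSpace X] [Nonempty X]
    (x : X) (Ω : Set X) (hΩ : IsStableNbhd x Ω) (Y : ℕ → Set X)
    (hY : IsStableDecomp x Ω Y)
    (W : Set (X ≃ₜ X)) (hsym : W = W⁻¹)
    (hcov : ∃ g : ℕ → X ≃ₜ X, (⋃ i, g i • W) = Set.univ)
    (A : Set X) (hA : IsBrick Y A) :
    ∃ Z : Set X, IsSubbrick Y A Z ∧ suppIn (Z ∪ {x}) ⊆ W ^ 8 := by
  obtain ⟨g, hg⟩ := hcov
  obtain ⟨S, hS, hSc, rfl⟩ := hA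
  obtain ⟨S₁, hS₁S, hS₁, h₁⟩ := hY.exists_subset_full hS hsym hg
  obtain ⟨S₂, hS₂S₁, hS₂, h₂⟩ := hY.exists_subset_full hS₁ hsym hg
  obtain ⟨T, hTS₂, hT, hS₂T, hcomm⟩ := hY.exists_subset_commutator hS₂
  have hS₂S := hS₂S₁.trans hS₁S
  refine ⟨pieces Y T, ⟨S, T, hS, hSc, hTS₂.trans hS₂S, hT,
    hS₂T.mono (Set.sdiff_subset_sdiff_left hS₂S), rfl, rfl⟩, fun f hf => ?_⟩
  have hTc : Tᶜ.Infinite := hS₂T.mono fun k hk => hk.2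
  obtain ⟨a, b, ha, hb, rfl⟩ := hcomm f (hY.suppOn_pieces hTc hf)
  obtain ⟨a', ha'W, -, ha'⟩ := h₁ a (ha.mono (pieces_mono hS₂S₁))
  obtain ⟨b', hb'W, hb's, hb'⟩ := h₂ b hb
  have hinv : ∀ w ∈ W ^ 2, w⁻¹ ∈ W ^ 2 := fun w hw => by
    rw [hsym, inv_pow]
    exact Set.inv_mem_inv.2 hw
  rw [← commutator_eq_of_eqOn (pieces_mono hS₂S₁) ha hb ha' hb' hb's,
    show W ^ 8 = W ^ 2 * W ^ 2 * W ^ 2 * W ^ 2 by simp only [← pow_add]]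
  exact Set.mul_mem_mul (Set.mul_mem_mul (Set.mul_mem_mul ha'W hb'W) (hinv a' ha'W))
    (hinv b' hb'W)
end
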